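/- arXiv:2008.01618 — 9 statements merged into one kernel-verified Lean document; each statement's English description precedes it below -/
import Mathlib

section
/- For every reserve price r ≥ 0, inf_{F ∈ Δ₁(m,v̄)} R(F,r) ≤ inf_{F ∈ Δ₁(m,v̄)} R(F,c). Hence the seller's own valuation c attains the supremum sup_{r ≥ 0} inf_{F ∈ Δ₁(m,v̄)} R(F,r): it is a maxmin reserve price for the second-price auction when the mean of values and an upper bound on values are known. -/
open MeasureTheory Set Filter

/-- Expected revenue of a second-price auction with `n` bidders, seller's valuation `c`,
value cdf `F` and reserve price `r`. -/
noncomputable def revenue (n : ℕ) (c : ℝ) (F : ℝ → ℝ) (r : ℝ) : ℝ :=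
  r - (r - c) * F r ^ n +
    ∫ v in Set.Ioi r, (1 - (n : ℝ) * F v ^ (n - 1) + ((n : ℝ) - 1) * F v ^ n)

/-- The set of cdfs with support in `[0, vbar]` and mean `m`. -/
def Delta1 (m vbar : ℝ) (F : ℝ → ℝ) : Prop :=
  Monotone F ∧ (∀ x, ContinuousWithinAt F (Set.Ici x) x) ∧
    (∀ v < 0, F v = 0) ∧ (∀ v ≥ vbar, F v = 1) ∧
    (∫ v in (0:ℝ)..vbar, (1 - F v)) = m

/-- The probability that the second highest of `k + 2` independent draws exceeds a level which
each draw stays below with probability `x`. -/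
def secondHighestTail (k : ℕ) (x : ℝ) : ℝ :=
  1 - ((k : ℝ) + 2) * x ^ (k + 1) + ((k : ℝ) + 1) * x ^ (k + 2)

/-- The decrease of `secondHighestTail k` from its value at `0`, divided by the argument. -/
def tailSlope (k : ℕ) (p : ℝ) : ℝ :=
  ((k : ℝ) + 2) * p ^ k - ((k : ℝ) + 1) * p ^ (k + 1)

lemma secondHighestTail_eq_one_sub (k : ℕ) (p : ℝ) :
    secondHighestTail k p = 1 - p * tailSlope k p := by
  unfold secondHighestTail tailSlope
  ring

lemma weighted_am_gm_pow (k : ℕ) {x p : ℝ} (hx : 0 ≤ x) (hp : 0 ≤ p) :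
    0 ≤ (k : ℝ) * x ^ (k + 1) - ((k : ℝ) + 1) * x ^ k * p + p ^ (k + 1) := by
  induction k with
  | zero => simp
  | succ k ih =>
    have hmul : 0 ≤ (x - p) * (x ^ (k + 1) - p ^ (k + 1)) := by
      rcases le_total x p with h | h
      · exact mul_nonneg_of_nonpos_of_nonpos (by linarith)
          (by linarith [pow_le_pow_left₀ hx h (k + 1)])
      · exact mul_nonneg (by linarith) (by linarith [pow_le_pow_left₀ hp h (k + 1)])
    push_cast
    linear_combination x * ih + hmul

lemma secondHighestTail_nonneg (k : ℕ) {x : ℝ} (hx : 0 ≤ x) : 0 ≤ secondHighestTail k x := by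
  have h := weighted_am_gm_pow (k + 1) hx zero_le_one
  push_cast at h
  unfold secondHighestTail
  linear_combination h

/-- To the right of `k (k + 2) / (k + 1) ^ 2`, tangent lines support `secondHighestTail k`
from below on the whole nonnegative half-line. -/
lemma tangent_le_secondHighestTail (k : ℕ) {x p : ℝ} (hx : 0 ≤ x) (hp : 0 < p)
    (hkp : (k : ℝ) * (k + 2) ≤ ((k : ℝ) + 1) ^ 2 * p) :
    secondHighestTail k p - ((k : ℝ) + 2) * (k + 1) * p ^ k * (1 - p) * (x - p) ≤
      secondHighestTail k x := by
  have h1 := mul_nonneg (sub_nonneg.2 hkp) (weighted_am_gm_pow (k + 1) hp.le hx)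
  have h2 := mul_nonneg (mul_nonneg (by positivity : (0 : ℝ) ≤ (k : ℝ) + 2) hx)
    (weighted_am_gm_pow k hx hp.le)
  have h3 : 0 ≤ (((k : ℝ) + 1) * p) * (secondHighestTail k x - (secondHighestTail k p -
      ((k : ℝ) + 2) * (k + 1) * p ^ k * (1 - p) * (x - p))) := by
    unfold secondHighestTail
    push_cast at h1
    linear_combination h1 + h2
  have h4 := nonneg_of_mul_nonneg_right h3 (by positivity)
  linarith

lemma monotoneOn_pow_add_mul_pow_mul_one_sub (k : ℕ) {q : ℝ} (hq : 0 < q) :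
    MonotoneOn (fun p : ℝ => p ^ (k + 2) + ((k : ℝ) + 2) * q * (p ^ k - p ^ (k + 1)))
      (Icc q 1) := by
  have hd : ∀ p : ℝ, HasDerivAt
      (fun p : ℝ => p ^ (k + 2) + ((k : ℝ) + 2) * q * (p ^ k - p ^ (k + 1)))
      (((k + 2 : ℕ) : ℝ) * p ^ (k + 1) +
        ((k : ℝ) + 2) * q * ((k : ℝ) * p ^ (k - 1) - ((k + 1 : ℕ) : ℝ) * p ^ k)) p := fun p =>
    (hasDerivAt_pow (k + 2) p).add
      (((hasDerivAt_pow k p).sub (hasDerivAt_pow (k + 1) p)).const_mul _)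
  refine monotoneOn_of_deriv_nonneg (convex_Icc q 1)
    (fun p _ => (hd p).continuousAt.continuousWithinAt)
    (fun p _ => (hd p).differentiableAt.differentiableWithinAt) fun p hp => ?_
  rw [interior_Icc] at hp
  obtain ⟨hqp, hp1⟩ := hp
  have hp0 : 0 < p := hq.trans hqp
  rw [(hd p).deriv]
  have hquad : 0 ≤ p ^ 2 + q * ((k : ℝ) - (k + 1) * p) := by
    rcases le_total 0 ((k : ℝ) - (k + 1) * p) with h | h
    · positivity
    · have h1 := mul_nonneg_of_nonpos_of_nonpos (sub_nonpos.2 hqp.le) h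
      have h2 : 0 ≤ (k : ℝ) * (p * (1 - p)) :=
        mul_nonneg (by positivity) (mul_nonneg hp0.le (by linarith))
      linear_combination h1 + h2
  have hpk : (k : ℝ) * p ^ (k - 1) * p = k * p ^ k := by
    cases k with
    | zero => simp
    | succ k => simp only [Nat.add_sub_cancel]; ring
  refine nonneg_of_mul_nonneg_right (a := p) ?_ hp0
  have h3 := mul_nonneg (by positivity : (0 : ℝ) ≤ ((k : ℝ) + 2) * p ^ k) hquad
  push_cast
  linear_combination h3 - ((k : ℝ) + 2) * q * hpk

lemma mul_tailSlope_le (k : ℕ) {q s p : ℝ} (hq : 0 < q) (hqs : q ≤ s) (hsp : s ≤ p)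
    (hp : p ≤ 1) :
    q * tailSlope k s ≤ p ^ (k + 2) + ((k : ℝ) + 2) * q * (p ^ k - p ^ (k + 1)) := by
  have h1 := monotoneOn_pow_add_mul_pow_mul_one_sub k hq ⟨hqs, hsp.trans hp⟩
    ⟨hqs.trans hsp, hp⟩ hsp
  simp only at h1
  have h2 := mul_nonneg (pow_nonneg (hq.le.trans hqs) (k + 1)) (sub_nonneg.2 hqs)
  refine le_trans ?_ h1
  unfold tailSlope
  linear_combination h2

lemma Delta1.nonneg {m vbar : ℝ} {F : ℝ → ℝ} (hF : Delta1 m vbar F) (v : ℝ) : 0 ≤ F v := by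
  rw [← hF.2.2.1 (min (v - 1) (-1)) (by linarith [min_le_right (v - 1) (-1)])]
  exact hF.1 (by linarith [min_le_left (v - 1) (-1)])

lemma Delta1.le_one {m vbar : ℝ} {F : ℝ → ℝ} (hF : Delta1 m vbar F) (v : ℝ) : F v ≤ 1 := by
  rw [← hF.2.2.2.1 (max v vbar) (le_max_right _ _)]
  exact hF.1 (le_max_left _ _)

lemma Delta1.intervalIntegrable_pow {m vbar : ℝ} {F : ℝ → ℝ} (hF : Delta1 m vbar F) (j : ℕ)
    (a b : ℝ) : IntervalIntegrable (fun v => F v ^ j) volume a b :=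
  Monotone.intervalIntegrable fun _ _ h => pow_le_pow_left₀ (hF.nonneg _) (hF.1 h) j

lemma Delta1.intervalIntegrable {m vbar : ℝ} {F : ℝ → ℝ} (hF : Delta1 m vbar F) (a b : ℝ) :
    IntervalIntegrable F volume a b :=
  hF.1.intervalIntegrable

lemma Delta1.intervalIntegrable_secondHighestTail {m vbar : ℝ} {F : ℝ → ℝ}
    (hF : Delta1 m vbar F) (k : ℕ) (a b : ℝ) :
    IntervalIntegrable (fun v => secondHighestTail k (F v)) volume a b :=
  (intervalIntegrable_const.sub ((hF.intervalIntegrable_pow (k + 1) a b).const_mul _)).add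
    ((hF.intervalIntegrable_pow (k + 2) a b).const_mul _)

lemma revenue_add_two (k : ℕ) (c : ℝ) (F : ℝ → ℝ) (r : ℝ) :
    revenue (k + 2) c F r =
      r - (r - c) * F r ^ (k + 2) + ∫ v in Ioi r, secondHighestTail k (F v) := by
  unfold revenue secondHighestTail
  rw [show k + 2 - 1 = k + 1 from rfl]
  congr 2
  funext v
  push_cast
  ring

lemma secondHighestTail_one (k : ℕ) : secondHighestTail k 1 = 0 := by
  unfold secondHighestTail
  simp only [one_pow]
  ring

lemma Delta1.revenue_eq {m vbar : ℝ} {F : ℝ → ℝ} (hF : Delta1 m vbar F) (k : ℕ) (c : ℝ)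
    {r : ℝ} (hr : r ≤ vbar) :
    revenue (k + 2) c F r =
      r - (r - c) * F r ^ (k + 2) + ∫ v in r..vbar, secondHighestTail k (F v) := by
  rw [revenue_add_two, intervalIntegral.integral_of_le hr]
  congr 1
  refine setIntegral_eq_of_subset_of_forall_sdiff_eq_zero measurableSet_Ioi
    Ioc_subset_Ioi_self fun v hv => ?_
  have hv' : vbar ≤ v := by
    by_contra! h
    exact hv.2 ⟨hv.1, h.le⟩
  rw [hF.2.2.2.1 v hv', secondHighestTail_one]

lemma revenue_of_eq_one (k : ℕ) (c : ℝ) {F : ℝ → ℝ} {r : ℝ} (h : ∀ v ≥ r, F v = 1) :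
    revenue (k + 2) c F r = c := by
  rw [revenue_add_two, h r le_rfl, setIntegral_eq_zero_of_forall_eq_zero fun v hv => by
    rw [h v (le_of_lt hv), secondHighestTail_one]]
  simp

lemma Delta1.revenue_nonneg {m vbar : ℝ} {F : ℝ → ℝ} (hF : Delta1 m vbar F) (k : ℕ) {c r : ℝ}
    (hc : 0 ≤ c) (hr : 0 ≤ r) : 0 ≤ revenue (k + 2) c F r := by
  rw [revenue_add_two]
  have h1 : 0 ≤ ∫ v in Ioi r, secondHighestTail k (F v) :=
    setIntegral_nonneg measurableSet_Ioi fun v _ => secondHighestTail_nonneg k (hF.nonneg v)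
  have h2 : 0 ≤ F r ^ (k + 2) := pow_nonneg (hF.nonneg r) _
  have h3 : F r ^ (k + 2) ≤ 1 := pow_le_one₀ (hF.nonneg r) (hF.le_one r)
  linear_combination h1 + c * h2 + r * h3

lemma Delta1.integral_le {c m vbar : ℝ} {F : ℝ → ℝ} (hF : Delta1 m vbar F) (hc : 0 ≤ c) :
    ∫ v in c..vbar, F v ≤ vbar - m := by
  have hm := hF.2.2.2.2
  rw [intervalIntegral.integral_sub intervalIntegrable_const (hF.intervalIntegrable _ _),
    intervalIntegral.integral_const,
    ← intervalIntegral.integral_add_adjacent_intervals (hF.intervalIntegrable 0 c)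
      (hF.intervalIntegrable c vbar)] at hm
  have h0 : 0 ≤ ∫ v in (0 : ℝ)..c, F v :=
    intervalIntegral.integral_nonneg hc fun v _ => hF.nonneg v
  simp only [smul_eq_mul] at hm
  linarith

/-- Jensen-type lower bound on the revenue at reserve price `c`. -/
lemma Delta1.le_revenue_self {c m vbar : ℝ} {F : ℝ → ℝ} (hF : Delta1 m vbar F) (k : ℕ)
    (hc : 0 ≤ c) (hcv : c ≤ vbar) {p : ℝ} (hp : 0 < p) (hp1 : p ≤ 1)
    (hkp : (k : ℝ) * (k + 2) ≤ ((k : ℝ) + 1) ^ 2 * p)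
    (hpq : ((vbar - c) * p - (vbar - m)) * ((k : ℝ) * (k + 2) - ((k : ℝ) + 1) ^ 2 * p) = 0) :
    vbar - (vbar - m) * tailSlope k p ≤ revenue (k + 2) c F c := by
  rw [hF.revenue_eq k c hcv]
  set s : ℝ := ((k : ℝ) + 2) * (k + 1) * p ^ k * (1 - p) with hs
  have hs0 : 0 ≤ s := mul_nonneg (by positivity) (by linarith)
  have hint : IntervalIntegrable (fun v => s * F v) volume c vbar :=
    (hF.intervalIntegrable c vbar).const_mul s
  have h1 : ∫ v in c..vbar, (secondHighestTail k p + s * p - s * F v) ≤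
      ∫ v in c..vbar, secondHighestTail k (F v) :=
    intervalIntegral.integral_mono_on hcv (intervalIntegrable_const.sub hint)
      (hF.intervalIntegrable_secondHighestTail k c vbar) fun v _ => by
        have := tangent_le_secondHighestTail k (hF.nonneg v) hp hkp
        rw [← hs] at this
        linarith
  rw [intervalIntegral.integral_sub intervalIntegrable_const hint,
    intervalIntegral.integral_const, intervalIntegral.integral_const_mul, smul_eq_mul,
    secondHighestTail_eq_one_sub] at h1
  have h2 := mul_le_mul_of_nonneg_left (hF.integral_le hc) hs0
  have h3 : ((vbar - c) * p - (vbar - m)) * (s - tailSlope k p) = 0 := by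
    rw [hs]
    unfold tailSlope
    linear_combination p ^ k * hpq
  linear_combination h1 + h2 - h3

/-- The cdf of the distribution with mass `p` at `b` and `1 - p` at `vbar`. -/
noncomputable def twoPointCdf (b p vbar : ℝ) (v : ℝ) : ℝ :=
  if v < b then 0 else if v < vbar then p else 1

lemma twoPointCdf_of_lt {b v : ℝ} (p vbar : ℝ) (h : v < b) : twoPointCdf b p vbar v = 0 :=
  if_pos h

lemma twoPointCdf_of_le_of_lt {b v vbar : ℝ} (p : ℝ) (h : b ≤ v) (h' : v < vbar) :
    twoPointCdf b p vbar v = p := by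
  rw [twoPointCdf, if_neg h.not_gt, if_pos h']

lemma twoPointCdf_of_ge {b v vbar : ℝ} (p : ℝ) (hb : b ≤ vbar) (h : vbar ≤ v) :
    twoPointCdf b p vbar v = 1 := by
  rw [twoPointCdf, if_neg (hb.trans h).not_gt, if_neg h.not_gt]

lemma delta1_twoPointCdf {b p m vbar : ℝ} (hb : 0 ≤ b) (hbv : b < vbar) (hp : 0 ≤ p)
    (hp1 : p ≤ 1) (hm : p * (vbar - b) = vbar - m) : Delta1 m vbar (twoPointCdf b p vbar) := by
  have hmono : Monotone (twoPointCdf b p vbar) := by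
    intro x y hxy
    unfold twoPointCdf
    split_ifs <;> linarith
  refine ⟨hmono, fun x => ?_, fun v hv => twoPointCdf_of_lt p vbar (hv.trans_le hb),
    fun v hv => twoPointCdf_of_ge p hbv.le hv, ?_⟩
  · suffices h : twoPointCdf b p vbar =ᶠ[nhdsWithin x (Ici x)] fun _ => twoPointCdf b p vbar x from
      continuousWithinAt_const.congr_of_eventuallyEq h rfl
    rcases lt_or_ge x b with hx | hx
    · filter_upwards [Ico_mem_nhdsGE hx] with v hv
      rw [twoPointCdf_of_lt p vbar hv.2, twoPointCdf_of_lt p vbar hx]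
    · rcases lt_or_ge x vbar with hx' | hx'
      · filter_upwards [Ico_mem_nhdsGE hx'] with v hv
        rw [twoPointCdf_of_le_of_lt p (hx.trans hv.1) hv.2, twoPointCdf_of_le_of_lt p hx hx']
      · filter_upwards [self_mem_nhdsWithin] with v hv
        rw [twoPointCdf_of_ge p hbv.le (hx'.trans hv), twoPointCdf_of_ge p hbv.le hx']
  · have hint : ∀ x y : ℝ, IntervalIntegrable (fun v => 1 - twoPointCdf b p vbar v) volume x y :=
      fun x y => intervalIntegrable_const.sub hmono.intervalIntegrable
    rw [← intervalIntegral.integral_add_adjacent_intervals (hint 0 b) (hint b vbar),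
      intervalIntegral.integral_congr_Ioo_of_le (g := fun _ => 1) hb fun v hv => by
        simp only [twoPointCdf_of_lt p vbar hv.2, sub_zero],
      intervalIntegral.integral_congr_Ioo_of_le (g := fun _ => 1 - p) hbv.le fun v hv => by
        simp only [twoPointCdf_of_le_of_lt p hv.1.le hv.2]]
    simp only [intervalIntegral.integral_const, smul_eq_mul]
    linear_combination -hm

lemma integral_secondHighestTail_twoPointCdf (k : ℕ) {b p r vbar : ℝ} (hbr : b ≤ r)
    (hrv : r ≤ vbar) :
    ∫ v in r..vbar, secondHighestTail k (twoPointCdf b p vbar v) =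
      (vbar - r) * secondHighestTail k p := by
  rw [intervalIntegral.integral_congr_Ioo_of_le (g := fun _ => secondHighestTail k p) hrv
    fun v hv => by simp only [twoPointCdf_of_le_of_lt p (hbr.trans hv.1.le) hv.2]]
  rw [intervalIntegral.integral_const, smul_eq_mul]

lemma revenue_twoPointCdf_of_lt (k : ℕ) {c b p r m vbar : ℝ} (hrb : r < b) (hbv : b ≤ vbar)
    (hF : Delta1 m vbar (twoPointCdf b p vbar)) :
    revenue (k + 2) c (twoPointCdf b p vbar) r = b + (vbar - b) * secondHighestTail k p := by
  rw [hF.revenue_eq k c (hrb.le.trans hbv), twoPointCdf_of_lt p vbar hrb,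
    ← intervalIntegral.integral_add_adjacent_intervals
      (hF.intervalIntegrable_secondHighestTail k r b)
      (hF.intervalIntegrable_secondHighestTail k b vbar),
    integral_secondHighestTail_twoPointCdf k le_rfl hbv,
    intervalIntegral.integral_congr_Ioo_of_le (g := fun _ => 1) hrb.le fun v hv => by
      simp [twoPointCdf_of_lt p vbar hv.2, secondHighestTail]]
  simp only [intervalIntegral.integral_const, smul_eq_mul]
  ring

lemma revenue_twoPointCdf_self (k : ℕ) {c b p m vbar : ℝ} (hbv : b < vbar)
    (hF : Delta1 m vbar (twoPointCdf b p vbar)) :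
    revenue (k + 2) c (twoPointCdf b p vbar) b =
      b - (b - c) * p ^ (k + 2) + (vbar - b) * secondHighestTail k p := by
  rw [hF.revenue_eq k c hbv.le, twoPointCdf_of_le_of_lt p le_rfl hbv,
    integral_secondHighestTail_twoPointCdf k le_rfl hbv.le]

/-- Against every reserve price some feasible cdf, concentrated on two points, keeps the revenue
at or below the guarantee of `Delta1.le_revenue_self`. -/
lemma exists_delta1_revenue_le (k : ℕ) {c m vbar p : ℝ} (hc : 0 ≤ c) (hcm : c < m)
    (hmv : m < vbar) (hqp : (vbar - m) / (vbar - c) ≤ p) (hp1 : p ≤ 1) {r : ℝ} (hr : 0 ≤ r) :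
    ∃ F, Delta1 m vbar F ∧
      revenue (k + 2) c F r ≤ vbar - (vbar - m) * tailSlope k p := by
  have hM : 0 < vbar - m := by linarith
  have hL : 0 < vbar - c := by linarith
  have hq : 0 < (vbar - m) / (vbar - c) := by positivity
  have hqL : (vbar - c) * ((vbar - m) / (vbar - c)) = vbar - m := by field_simp
  have hp : 0 < p := hq.trans_le hqp
  rcases le_or_gt m r with hmr | hrm
  · have hF := delta1_twoPointCdf (p := 1) (hc.trans hcm.le) hmv zero_le_one le_rfl (one_mul _)
    refine ⟨_, hF, ?_⟩
    rw [revenue_of_eq_one k c fun v hv => by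
      unfold twoPointCdf
      rw [if_neg (hmr.trans hv).not_gt, ite_self]]
    have h := mul_le_mul_of_nonneg_left (mul_tailSlope_le k hq hqp hp1 le_rfl) hL.le
    simp only [one_pow, sub_self, mul_zero, add_zero] at h
    linear_combination h - tailSlope k p * hqL
  rcases lt_or_ge r (vbar - (vbar - m) / p) with hra | har
  · have hav : vbar - (vbar - m) / p < vbar := by linarith [div_pos hM hp]
    have hF : Delta1 m vbar (twoPointCdf (vbar - (vbar - m) / p) p vbar) :=
      delta1_twoPointCdf (hr.trans hra.le) hav hp.le hp1 (by field_simp; ring)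
    refine ⟨_, hF, ?_⟩
    rw [revenue_twoPointCdf_of_lt k hra hav.le hF, secondHighestTail_eq_one_sub]
    apply le_of_eq
    field_simp
    ring
  · have hD : 0 < vbar - r := by linarith
    set t := (vbar - m) / (vbar - r) with ht
    have htD : t * (vbar - r) = vbar - m := by rw [ht]; field_simp
    have ht1 : t ≤ 1 := by rw [ht, div_le_one hD]; linarith
    have hpt : p ≤ t := by
      rw [ht, le_div_iff₀ hD]
      have := (le_div_iff₀ hp).1 (by linarith : vbar - r ≤ (vbar - m) / p)
      linarith
    have hF := delta1_twoPointCdf hr (by linarith : r < vbar) (hp.le.trans hpt) ht1 htD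
    refine ⟨_, hF, ?_⟩
    rw [revenue_twoPointCdf_self k (by linarith) hF, secondHighestTail_eq_one_sub]
    have h := mul_le_mul_of_nonneg_left (mul_tailSlope_le k hq hqp hpt ht1) hL.le
    have h1 : (vbar - m) * tailSlope k p ≤ (vbar - c) * t ^ (k + 2) +
        ((k : ℝ) + 2) * (vbar - m) * (t ^ k - t ^ (k + 1)) := by
      linear_combination h +
        (((k : ℝ) + 2) * (t ^ k - t ^ (k + 1)) - tailSlope k p) * hqL
    have h2 : (vbar - r) * (1 - t * tailSlope k t) =
        vbar - r - (vbar - m) * tailSlope k t := by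
      linear_combination -tailSlope k t * htD
    have h3 : (vbar - r) * t ^ (k + 2) = (vbar - m) * t ^ (k + 1) := by
      linear_combination t ^ (k + 1) * htD
    rw [h2]
    unfold tailSlope at h1 ⊢
    linear_combination h1 + h3

theorem maxmin_reserve_is_sellers_valuation_delta1
    (n : ℕ) (hn : 2 ≤ n) (c m vbar : ℝ)
    (hc : 0 ≤ c) (hcm : c < m) (hmv : m < vbar) :
    (∀ r : ℝ, 0 ≤ r →
      sInf {x | ∃ F, Delta1 m vbar F ∧ x = revenue n c F r} ≤
        sInf {x | ∃ F, Delta1 m vbar F ∧ x = revenue n c F c}) ∧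
    sInf {x | ∃ F, Delta1 m vbar F ∧ x = revenue n c F c} =
      sSup {y | ∃ r : ℝ, 0 ≤ r ∧
        y = sInf {x | ∃ F, Delta1 m vbar F ∧ x = revenue n c F r}} := by
  obtain ⟨k, rfl⟩ : ∃ k, n = k + 2 := ⟨n - 2, by omega⟩
  have hL : 0 < vbar - c := by linarith
  have hq : 0 < (vbar - m) / (vbar - c) := div_pos (by linarith) hL
  have hk : (0 : ℝ) < ((k : ℝ) + 1) ^ 2 := by positivity
  set p : ℝ := max ((vbar - m) / (vbar - c)) ((k : ℝ) * (k + 2) / ((k : ℝ) + 1) ^ 2) with hp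
  have hqp : (vbar - m) / (vbar - c) ≤ p := le_max_left _ _
  have hkp : (k : ℝ) * (k + 2) ≤ ((k : ℝ) + 1) ^ 2 * p := by
    rw [← div_le_iff₀' hk]
    exact le_max_right _ _
  have hp1 : p ≤ 1 := by
    refine max_le ((div_le_one hL).2 (by linarith)) ((div_le_one hk).2 (by nlinarith))
  have hpq : ((vbar - c) * p - (vbar - m)) *
      ((k : ℝ) * (k + 2) - ((k : ℝ) + 1) ^ 2 * p) = 0 := by
    rcases max_choice ((vbar - m) / (vbar - c)) ((k : ℝ) * (k + 2) / ((k : ℝ) + 1) ^ 2)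
      with h | h
    · rw [hp, h, mul_div_cancel₀ _ hL.ne', sub_self, zero_mul]
    · rw [hp, h, mul_div_cancel₀ _ hk.ne', sub_self, mul_zero]
  have hguarantee : ∀ r : ℝ, 0 ≤ r →
      sInf {x | ∃ F, Delta1 m vbar F ∧ x = revenue (k + 2) c F r} ≤
        sInf {x | ∃ F, Delta1 m vbar F ∧ x = revenue (k + 2) c F c} := by
    intro r hr
    obtain ⟨F, hF, hle⟩ := exists_delta1_revenue_le k hc hcm hmv hqp hp1 hr
    have hbdd : BddBelow {x | ∃ F, Delta1 m vbar F ∧ x = revenue (k + 2) c F r} := by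
      refine ⟨0, ?_⟩
      rintro _ ⟨G, hG, rfl⟩
      exact hG.revenue_nonneg k hc hr
    refine le_trans (csInf_le hbdd ⟨F, hF, rfl⟩) (hle.trans (le_csInf ⟨_, F, hF, rfl⟩ ?_))
    rintro _ ⟨G, hG, rfl⟩
    exact hG.le_revenue_self k hc (by linarith) (hq.trans_le hqp) hp1 hkp hpq
  refine ⟨hguarantee, Eq.symm (IsGreatest.csSup_eq ?_)⟩
  refine ⟨⟨c, hc, rfl⟩, ?_⟩
  rintro _ ⟨r, hr, rfl⟩
  exact hguarantee r hr
end

section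
/- For every F ∈ Δ₁(m,v̄) there exists F̃ ∈ Δ₁(m,v̄) with F̃(v) = 0 for all v < c (i.e. F̃ puts no mass below c) such that R(F̃,c) ≤ R(F,c). Concretely, one may take β := (m − c)/∫_c^{v̄}(1 − F(v))dv ∈ (0,1] and F̃(v) := 0 for v < c and F̃(v) := β·F(v) + (1 − β) for v ≥ c. -/
open MeasureTheory Set Filter

/-- The probability that the second highest of `n` iid draws exceeds a value, as a function of
the cdf at that value, is antitone. -/
theorem antitoneOn_secondHighestTail {n : ℕ} (hn : 2 ≤ n) :
    AntitoneOn (fun x : ℝ => 1 - (n : ℝ) * x ^ (n - 1) + ((n : ℝ) - 1) * x ^ n) (Icc 0 1) := by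
  obtain ⟨k, rfl⟩ := Nat.exists_eq_add_of_le' hn
  have hderiv : ∀ x : ℝ, HasDerivAt
      (fun x : ℝ => 1 - ((k + 2 : ℕ) : ℝ) * x ^ (k + 2 - 1) + (((k + 2 : ℕ) : ℝ) - 1) * x ^ (k + 2))
      (-(((k : ℝ) + 2) * (k + 1) * x ^ k * (1 - x))) x := by
    intro x
    have h := (((hasDerivAt_pow (k + 1) x).const_mul ((k : ℝ) + 2)).const_sub 1).add
      ((hasDerivAt_pow (k + 2) x).const_mul ((k : ℝ) + 1))
    refine (h.congr_of_eventuallyEq (Eventually.of_forall fun y => ?_)).congr_deriv ?_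
    · simp only [Pi.add_apply, Nat.add_succ_sub_one]
      push_cast
      ring
    · simp only [Nat.add_succ_sub_one, Nat.add_zero]
      push_cast
      ring
  refine antitoneOn_of_deriv_nonpos (convex_Icc 0 1)
    (fun x _ => (hderiv x).continuousAt.continuousWithinAt)
    (fun x _ => (hderiv x).differentiableAt.differentiableWithinAt) fun x hx => ?_
  rw [interior_Icc] at hx
  rw [(hderiv x).deriv]
  have h₀ : 0 ≤ x := hx.1.le
  have h₁ : 0 ≤ 1 - x := by linarith [hx.2]
  have : 0 ≤ ((k : ℝ) + 2) * (k + 1) * x ^ k * (1 - x) := by positivity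
  linarith

theorem Delta1.mem_Icc {m vbar : ℝ} {F : ℝ → ℝ} (hF : Delta1 m vbar F) (v : ℝ) :
    F v ∈ Icc (0 : ℝ) 1 := by
  obtain ⟨hmono, -, hzero, hone, -⟩ := hF
  constructor
  · rw [← hzero (min v 0 - 1) (by linarith [min_le_right v 0])]
    exact hmono (by linarith [min_le_left v 0])
  · rw [← hone (max v vbar) (le_max_right _ _)]
    exact hmono (le_max_left _ _)

theorem Delta1.integrableOn_secondHighestTail {n : ℕ} (hn : 2 ≤ n) {m vbar : ℝ} {F : ℝ → ℝ}
    (hF : Delta1 m vbar F) (r : ℝ) :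
    IntegrableOn (fun v => 1 - (n : ℝ) * F v ^ (n - 1) + ((n : ℝ) - 1) * F v ^ n) (Ioi r) := by
  have hanti : Antitone (fun v => 1 - (n : ℝ) * F v ^ (n - 1) + ((n : ℝ) - 1) * F v ^ n) :=
    fun v w hvw => antitoneOn_secondHighestTail hn (hF.mem_Icc v) (hF.mem_Icc w) (hF.1 hvw)
  have hbounded : IntegrableOn
      (fun v => 1 - (n : ℝ) * F v ^ (n - 1) + ((n : ℝ) - 1) * F v ^ n) (Icc r vbar) :=
    (hanti.antitoneOn _).integrableOn_isCompact isCompact_Icc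
  have htail : IntegrableOn
      (fun v => 1 - (n : ℝ) * F v ^ (n - 1) + ((n : ℝ) - 1) * F v ^ n) (Ici vbar) := by
    refine integrableOn_zero.congr_fun (fun v hv => ?_) measurableSet_Ici
    simp [hF.2.2.2.1 v hv]
  refine (hbounded.union htail).mono_set fun v hv => ?_
  rcases le_total v vbar with h | h
  · exact Or.inl ⟨le_of_lt hv, h⟩
  · exact Or.inr h

theorem no_mass_below_c_delta1
    (n : ℕ) (hn : 2 ≤ n) (c m vbar : ℝ)
    (hc : 0 ≤ c) (hcm : c < m) (hmv : m < vbar)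
    (F : ℝ → ℝ) (hF : Delta1 m vbar F) :
    let β : ℝ := (m - c) / ∫ v in c..vbar, (1 - F v)
    let Ft : ℝ → ℝ := fun v => if v < c then 0 else β * F v + (1 - β)
    β ∈ Set.Ioc (0:ℝ) 1 ∧ Delta1 m vbar Ft ∧ (∀ v < c, Ft v = 0) ∧
      revenue n c Ft c ≤ revenue n c F c := by
  intro β Ft
  have hbd := hF.mem_Icc
  obtain ⟨hmono, hcont, hzero, hone, hmean⟩ := id hF
  have hint : ∀ a b : ℝ, IntervalIntegrable (fun v => 1 - F v) volume a b := fun a b =>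
    intervalIntegrable_const.sub hmono.intervalIntegrable
  have hsplit := intervalIntegral.integral_add_adjacent_intervals (hint 0 c) (hint c vbar)
  have hlow : ∫ v in (0 : ℝ)..c, (1 - F v) ≤ c := by
    have h := intervalIntegral.integral_mono_on hc (hint 0 c)
      (intervalIntegrable_const (c := (1 : ℝ))) fun v _ => by linarith [(hbd v).1]
    simpa using h
  have hle : m - c ≤ ∫ v in c..vbar, (1 - F v) := by linarith
  have hpos : 0 < ∫ v in c..vbar, (1 - F v) := by linarith
  have hβ₀ : 0 < β := div_pos (by linarith) hpos
  have hβ₁ : β ≤ 1 := (div_le_one hpos).2 hle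
  have hβ : β * ∫ v in c..vbar, (1 - F v) = m - c := div_mul_cancel₀ _ hpos.ne'
  have hbelow : ∀ v < c, Ft v = 0 := fun v hv => if_pos hv
  have habove : ∀ v, c ≤ v → Ft v = β * F v + (1 - β) := fun v hv => if_neg hv.not_gt
  have hFt : Delta1 m vbar Ft := by
    refine ⟨fun v w hvw => ?_, fun x => ?_, fun v hv => hbelow v (hv.trans_le hc),
      fun v hv => ?_, ?_⟩
    · rcases lt_or_ge w c with hw | hw
      · rw [hbelow w hw, hbelow v (hvw.trans_lt hw)]
      · rw [habove w hw]
        rcases lt_or_ge v c with hv | hv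
        · rw [hbelow v hv]
          nlinarith [(hbd w).1]
        · rw [habove v hv]
          nlinarith [hmono hvw]
    · rcases lt_or_ge x c with hx | hx
      · refine ContinuousAt.continuousWithinAt ?_
        refine (continuousAt_const (y := (0 : ℝ))).congr ?_
        filter_upwards [Iio_mem_nhds hx] with v hv
        exact (hbelow v hv).symm
      · exact ((continuousWithinAt_const.mul (hcont x)).add continuousWithinAt_const).congr
          (fun v hv => habove v (hx.trans hv)) (habove x hx)
    · rw [habove v (by linarith), hone v hv]
      ring
    · have hzero_part : EqOn (fun _ => (1 : ℝ)) (fun v => 1 - Ft v) (Ioo 0 c) := fun v hv => by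
        simp [hbelow v hv.2]
      have habove_part : EqOn (fun v => β * (1 - F v)) (fun v => 1 - Ft v) (uIcc c vbar) := by
        intro v hv
        rw [uIcc_of_le (by linarith)] at hv
        simp only [habove v hv.1]
        ring
      have hi₁ : IntervalIntegrable (fun v => 1 - Ft v) volume 0 c :=
        intervalIntegrable_const.congr_uIoo (by rwa [uIoo_of_le hc])
      have hi₂ : IntervalIntegrable (fun v => 1 - Ft v) volume c vbar :=
        ((hint c vbar).const_mul β).congr fun v hv => habove_part (uIoc_subset_uIcc hv)
      rw [← intervalIntegral.integral_add_adjacent_intervals hi₁ hi₂,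
        ← intervalIntegral.integral_congr_Ioo_of_le hc hzero_part,
        ← intervalIntegral.integral_congr habove_part,
        intervalIntegral.integral_const_mul, hβ]
      simp
  refine ⟨⟨hβ₀, hβ₁⟩, hFt, hbelow, ?_⟩
  simp only [revenue, sub_self, zero_mul, sub_zero]
  refine add_le_add_right (setIntegral_mono_on (hFt.integrableOn_secondHighestTail hn c)
    (hF.integrableOn_secondHighestTail hn c) measurableSet_Ioi fun v hv => ?_) c
  refine antitoneOn_secondHighestTail hn (hbd v) (hFt.mem_Icc v) ?_
  rw [habove v (le_of_lt hv)]
  nlinarith [(hbd v).2]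
end

section
/- Let λ* := n(n−1)·z(q*_n). Then λ* = min_{y ∈ (0,1]} ((n−1)y^n − n·y^{n−1})/y (where the function is extended by continuity at 0), and for every λ ∈ ℝ the set of minimizers over F ∈ [0,1] of the function F ↦ (n−1)F^n − n·F^{n−1} − λ·F is: {0} if λ < λ*; {0, q*_n} if λ = λ*; the singleton {y(λ)}, where y(λ) is the unique solution y ∈ (q*_n, 1) of n(n−1)·y^{n−2}(y − 1) = λ, if λ* < λ < 0; and {1} if λ ≥ 0. -/
open Set

/-- The critical quantile `1 - 1 / (m + 1) ^ 2`. -/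
noncomputable def critQuantile (m : ℕ) : ℝ := 1 - 1 / ((m : ℝ) + 1) ^ 2

/-- The average cost `((n - 1) y ^ n - n y ^ (n - 1)) / y` for `n = m + 2`, extended to `0`. -/
noncomputable def averageCost (m : ℕ) (y : ℝ) : ℝ :=
  ((m : ℝ) + 1) * y ^ (m + 1) - ((m : ℝ) + 2) * y ^ m

/-- The marginal cost `n (n - 1) y ^ (n - 2) (y - 1)` for `n = m + 2`. -/
noncomputable def marginalCost (m : ℕ) (y : ℝ) : ℝ :=
  ((m : ℝ) + 2) * ((m : ℝ) + 1) * y ^ m * (y - 1)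

/-- The Lagrangian integrand, up to a constant. -/
noncomputable def penalizedCost (m : ℕ) (lam y : ℝ) : ℝ :=
  ((m : ℝ) + 1) * y ^ (m + 2) - ((m : ℝ) + 2) * y ^ (m + 1) - lam * y

lemma critQuantile_nonneg (m : ℕ) : 0 ≤ critQuantile m := by
  have h : (1 : ℝ) ≤ ((m : ℝ) + 1) ^ 2 := one_le_pow₀ (by linarith [m.cast_nonneg (α := ℝ)])
  have := (div_le_one (by positivity)).2 h
  unfold critQuantile
  linarith

lemma critQuantile_lt_one (m : ℕ) : critQuantile m < 1 := by
  have : (0 : ℝ) < 1 / ((m : ℝ) + 1) ^ 2 := by positivity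
  unfold critQuantile
  linarith

lemma sq_mul_critQuantile (m : ℕ) :
    ((m : ℝ) + 1) ^ 2 * critQuantile m = (m : ℝ) * (m + 2) := by
  have : (m : ℝ) + 1 ≠ 0 := by positivity
  unfold critQuantile
  field_simp
  ring

lemma marginalCost_eq (m : ℕ) (y : ℝ) :
    marginalCost m y = averageCost m y + ((m : ℝ) + 1) ^ 2 * y ^ m * (y - critQuantile m) := by
  unfold marginalCost averageCost
  linear_combination y ^ m * sq_mul_critQuantile m

lemma marginalCost_critQuantile (m : ℕ) :
    marginalCost m (critQuantile m) = averageCost m (critQuantile m) := by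
  simp [marginalCost_eq]

lemma penalizedCost_eq (m : ℕ) (lam y : ℝ) :
    penalizedCost m lam y = y * (averageCost m y - lam) := by
  unfold penalizedCost averageCost
  ring

lemma continuous_averageCost (m : ℕ) : Continuous (averageCost m) := by
  unfold averageCost
  fun_prop

lemma continuous_penalizedCost (m : ℕ) (lam : ℝ) : Continuous (penalizedCost m lam) := by
  unfold penalizedCost
  fun_prop

lemma hasDerivAt_penalizedCost (m : ℕ) (lam y : ℝ) :
    HasDerivAt (penalizedCost m lam) (marginalCost m y - lam) y := by
  have h := (((hasDerivAt_pow (m + 2) y).const_mul ((m : ℝ) + 1)).sub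
    ((hasDerivAt_pow (m + 1) y).const_mul ((m : ℝ) + 2))).sub ((hasDerivAt_id y).const_mul lam)
  refine h.congr_deriv ?_
  simp only [marginalCost, Nat.add_sub_cancel, show m + 2 - 1 = m + 1 from rfl]
  push_cast
  ring

lemma hasDerivAt_averageCost (m : ℕ) {y : ℝ} (hy : 0 < y) :
    HasDerivAt (averageCost m) (((m : ℝ) + 1) ^ 2 * y ^ m * (y - critQuantile m) / y) y := by
  have h := ((hasDerivAt_pow (m + 1) y).const_mul ((m : ℝ) + 1)).sub
    ((hasDerivAt_pow m y).const_mul ((m : ℝ) + 2))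
  refine h.congr_deriv ?_
  rw [eq_div_iff hy.ne']
  have hm : (m : ℝ) * y ^ (m - 1) * y = m * y ^ m := by
    cases m with
    | zero => simp
    | succ k => simp only [Nat.add_sub_cancel]; ring
  simp only [Nat.add_sub_cancel]
  push_cast
  linear_combination -((m : ℝ) + 2) * hm + y ^ m * sq_mul_critQuantile m

lemma strictAntiOn_averageCost (m : ℕ) :
    StrictAntiOn (averageCost m) (Icc 0 (critQuantile m)) := by
  refine strictAntiOn_of_deriv_neg (convex_Icc _ _) (continuous_averageCost m).continuousOn ?_
  intro y hy
  rw [interior_Icc] at hy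
  have hy0 := hy.1
  rw [(hasDerivAt_averageCost m hy0).deriv]
  exact div_neg_of_neg_of_pos (mul_neg_of_pos_of_neg (by positivity) (sub_neg.2 hy.2)) hy0

lemma strictMonoOn_averageCost (m : ℕ) :
    StrictMonoOn (averageCost m) (Ici (critQuantile m)) := by
  refine strictMonoOn_of_deriv_pos (convex_Ici _) (continuous_averageCost m).continuousOn ?_
  intro y hy
  rw [interior_Ici] at hy
  have hy0 : 0 < y := (critQuantile_nonneg m).trans_lt hy
  rw [(hasDerivAt_averageCost m hy0).deriv]
  have := sub_pos.2 (mem_Ioi.1 hy)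
  positivity

lemma averageCost_critQuantile_lt (m : ℕ) {y : ℝ} (hy : 0 ≤ y) (hne : y ≠ critQuantile m) :
    averageCost m (critQuantile m) < averageCost m y := by
  rcases lt_or_gt_of_ne hne with h | h
  · exact strictAntiOn_averageCost m ⟨hy, h.le⟩ ⟨critQuantile_nonneg m, le_rfl⟩ h
  · exact strictMonoOn_averageCost m self_mem_Ici h.le h

lemma averageCost_critQuantile_le (m : ℕ) {y : ℝ} (hy : 0 ≤ y) :
    averageCost m (critQuantile m) ≤ averageCost m y := by
  rcases eq_or_ne y (critQuantile m) with rfl | h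
  · exact le_rfl
  · exact (averageCost_critQuantile_lt m hy h).le

lemma strictMonoOn_marginalCost (m : ℕ) :
    StrictMonoOn (marginalCost m) (Ici (critQuantile m)) := by
  intro x hx y hy hxy
  have hx0 : 0 ≤ x := (critQuantile_nonneg m).trans hx
  have hA := strictMonoOn_averageCost m hx hy hxy
  have hy0 : 0 ≤ y := hx0.trans hxy.le
  have hx1 := sub_nonneg.2 (mem_Ici.1 hx)
  have hB : ((m : ℝ) + 1) ^ 2 * x ^ m * (x - critQuantile m) ≤
      ((m : ℝ) + 1) ^ 2 * y ^ m * (y - critQuantile m) := by gcongr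
  rw [marginalCost_eq, marginalCost_eq]
  linarith

/-- The minimizers of the penalized cost over `[0, 1]`. -/
def costMinimizers (m : ℕ) (lam : ℝ) : Set ℝ :=
  {F | F ∈ Icc (0 : ℝ) 1 ∧ ∀ y ∈ Icc (0 : ℝ) 1, penalizedCost m lam F ≤ penalizedCost m lam y}

lemma costMinimizers_nonempty (m : ℕ) (lam : ℝ) : (costMinimizers m lam).Nonempty := by
  obtain ⟨F, hF, hmin⟩ := isCompact_Icc.exists_isMinOn (nonempty_Icc.2 (zero_le_one (α := ℝ)))
    (continuous_penalizedCost m lam).continuousOn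
  exact ⟨F, hF, fun y hy => hmin hy⟩

lemma costMinimizers_of_lt {m : ℕ} {lam : ℝ}
    (h : lam < averageCost m (critQuantile m)) : costMinimizers m lam = {0} := by
  refine (costMinimizers_nonempty m lam).subset_singleton_iff.1 ?_
  rintro F ⟨hF, hmin⟩
  by_contra hne
  have hpos : 0 < F := lt_of_le_of_ne hF.1 (Ne.symm hne)
  have h0 := hmin 0 ⟨le_rfl, zero_le_one⟩
  rw [penalizedCost_eq, penalizedCost_eq, zero_mul] at h0
  have := averageCost_critQuantile_le m hF.1
  exact absurd h0 (not_le.2 (mul_pos hpos (by linarith)))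

lemma costMinimizers_averageCost_critQuantile (m : ℕ) :
    costMinimizers m (averageCost m (critQuantile m)) = {0, critQuantile m} := by
  have hnonneg : ∀ y ∈ Icc (0 : ℝ) 1,
      0 ≤ penalizedCost m (averageCost m (critQuantile m)) y := fun y hy => by
    rw [penalizedCost_eq]
    exact mul_nonneg hy.1 (sub_nonneg.2 (averageCost_critQuantile_le m hy.1))
  ext F
  constructor
  · rintro ⟨hF, hmin⟩
    by_contra hne
    simp only [mem_insert_iff, mem_singleton_iff, not_or] at hne
    have h0 := hmin 0 ⟨le_rfl, zero_le_one⟩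
    rw [penalizedCost_eq, penalizedCost_eq, zero_mul] at h0
    have hpos : 0 < F := lt_of_le_of_ne hF.1 (Ne.symm hne.1)
    have := averageCost_critQuantile_lt m hF.1 hne.2
    exact absurd h0 (not_le.2 (mul_pos hpos (by linarith)))
  · rintro (rfl | rfl)
    · refine ⟨⟨le_rfl, zero_le_one⟩, fun y hy => ?_⟩
      rw [penalizedCost_eq, zero_mul]
      exact hnonneg y hy
    · refine ⟨⟨critQuantile_nonneg m, (critQuantile_lt_one m).le⟩, fun y hy => ?_⟩
      rw [penalizedCost_eq, sub_self, mul_zero]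
      exact hnonneg y hy

lemma marginalCost_eq_of_mem_costMinimizers {m : ℕ} {lam F : ℝ}
    (hF : F ∈ costMinimizers m lam) (h0 : F ≠ 0) (h1 : F ≠ 1) : marginalCost m F = lam := by
  have hlt0 : 0 < F := lt_of_le_of_ne hF.1.1 (Ne.symm h0)
  have hlt1 : F < 1 := lt_of_le_of_ne hF.1.2 h1
  have hmin : IsMinOn (penalizedCost m lam) (Icc 0 1) F := fun y hy => hF.2 y hy
  exact sub_eq_zero.1 ((hmin.isLocalMin (Icc_mem_nhds hlt0 hlt1)).hasDerivAt_eq_zero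
    (hasDerivAt_penalizedCost m lam F))

lemma exists_averageCost_lt {m : ℕ} {lam : ℝ} (h : averageCost m (critQuantile m) < lam) :
    ∃ y ∈ Ioo (critQuantile m) 1, averageCost m y < lam := by
  have hev := ((continuous_averageCost m).tendsto (critQuantile m)).eventually_lt_const h
  have hIoo : ∀ᶠ y in nhdsWithin (critQuantile m) (Ioi (critQuantile m)),
      y ∈ Ioo (critQuantile m) 1 := Ioo_mem_nhdsGT (critQuantile_lt_one m)
  obtain ⟨y, hy, hlt⟩ := (hIoo.and (hev.filter_mono nhdsWithin_le_nhds)).exists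
  exact ⟨y, hy, hlt⟩

lemma mem_Ioo_of_mem_costMinimizers {m : ℕ} {lam F : ℝ}
    (hlam : averageCost m (critQuantile m) < lam) (hneg : lam < 0)
    (hF : F ∈ costMinimizers m lam) :
    F ∈ Ioo (critQuantile m) 1 ∧ marginalCost m F = lam := by
  obtain ⟨y, hy, hlt⟩ := exists_averageCost_lt hlam
  have hy0 : 0 < y := (critQuantile_nonneg m).trans_lt hy.1
  have hcost : penalizedCost m lam F < 0 := by
    refine (hF.2 y ⟨hy0.le, hy.2.le⟩).trans_lt ?_
    rw [penalizedCost_eq]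
    exact mul_neg_of_pos_of_neg hy0 (sub_neg.2 hlt)
  have h0 : F ≠ 0 := by
    rintro rfl
    simp [penalizedCost_eq] at hcost
  have hpos : 0 < F := lt_of_le_of_ne hF.1.1 (Ne.symm h0)
  have h1 : F ≠ 1 := by
    rintro rfl
    have hmin : IsMinOn (penalizedCost m lam) (Icc 0 1) 1 := fun y hy => hF.2 y hy
    have hcone : (0 : ℝ) - 1 ∈ posTangentConeAt (Icc (0 : ℝ) 1) 1 :=
      sub_mem_posTangentConeAt_of_segment_subset
        ((convex_Icc (0 : ℝ) 1).segment_subset ⟨zero_le_one, le_rfl⟩ ⟨le_rfl, zero_le_one⟩)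
    have := hmin.localize.hasFDerivWithinAt_nonneg
      (hasDerivAt_penalizedCost m lam 1).hasFDerivAt.hasFDerivWithinAt hcone
    simp [marginalCost] at this
    linarith
  have hmarg := marginalCost_eq_of_mem_costMinimizers hF h0 h1
  refine ⟨⟨?_, lt_of_le_of_ne hF.1.2 h1⟩, hmarg⟩
  rw [penalizedCost_eq] at hcost
  have hav : averageCost m F - lam < 0 := neg_of_mul_neg_right hcost hpos.le
  have hgap : 0 < ((m : ℝ) + 1) ^ 2 * F ^ m * (F - critQuantile m) := by
    linarith [marginalCost_eq m F]
  exact sub_pos.1 (pos_of_mul_pos_right hgap (by positivity))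

lemma costMinimizers_of_nonneg {m : ℕ} {lam : ℝ} (h : 0 ≤ lam) : costMinimizers m lam = {1} := by
  refine (costMinimizers_nonempty m lam).subset_singleton_iff.1 ?_
  intro F hF
  by_contra h1
  have h0 : F ≠ 0 := by
    rintro rfl
    have := hF.2 1 ⟨zero_le_one, le_rfl⟩
    simp only [penalizedCost, one_pow] at this
    norm_num at this
    linarith
  have hpos : 0 < F := lt_of_le_of_ne hF.1.1 (Ne.symm h0)
  have hlt1 : F < 1 := lt_of_le_of_ne hF.1.2 h1
  have hmarg := marginalCost_eq_of_mem_costMinimizers hF h0 h1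
  have : marginalCost m F < 0 := mul_neg_of_pos_of_neg (by positivity) (sub_neg.2 hlt1)
  linarith

theorem supply_curve_lemma (n : ℕ) (hn : 2 ≤ n) :
    let z : ℝ → ℝ := fun y => y ^ (n - 1) - y ^ (n - 2)
    let qstar : ℝ := 1 - 1 / ((n : ℝ) - 1) ^ 2
    let lamstar : ℝ := (n : ℝ) * ((n : ℝ) - 1) * z qstar
    -- the function ((n−1)y^n − n·y^{n−1})/y, extended by continuity at 0
    let AC : ℝ → ℝ := fun y => ((n : ℝ) - 1) * y ^ (n - 1) - (n : ℝ) * y ^ (n - 2)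
    let argmin : ℝ → Set ℝ := fun lam =>
      {F | F ∈ Set.Icc (0:ℝ) 1 ∧ ∀ y ∈ Set.Icc (0:ℝ) 1,
        ((n : ℝ) - 1) * F ^ n - (n : ℝ) * F ^ (n - 1) - lam * F ≤
          ((n : ℝ) - 1) * y ^ n - (n : ℝ) * y ^ (n - 1) - lam * y}
    IsLeast (AC '' Set.Icc (0:ℝ) 1) lamstar ∧
    ∀ lam : ℝ,
      (lam < lamstar → argmin lam = {0}) ∧
      (lam = lamstar → argmin lam = ({0, qstar} : Set ℝ)) ∧
      (lamstar < lam → lam < 0 →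
        ∃! y : ℝ, y ∈ Set.Ioo qstar 1 ∧
          (n : ℝ) * ((n : ℝ) - 1) * y ^ (n - 2) * (y - 1) = lam ∧
          argmin lam = {y}) ∧
      (0 ≤ lam → argmin lam = {1}) := by
  intro z qstar lamstar AC argmin
  obtain ⟨m, rfl⟩ := Nat.exists_eq_add_of_le' hn
  have hcast : ((m + 2 : ℕ) : ℝ) = (m : ℝ) + 2 := by push_cast; rfl
  have hcast' : (m : ℝ) + 2 - 1 = (m : ℝ) + 1 := by ring
  have hq : qstar = critQuantile m := by simp only [qstar, critQuantile, hcast, hcast']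
  have hAC : AC = averageCost m := by
    funext y
    simp only [AC, averageCost, hcast, hcast', Nat.add_sub_cancel, show m + 2 - 1 = m + 1 from rfl]
  have hlamstar : lamstar = averageCost m (critQuantile m) := by
    rw [← marginalCost_critQuantile]
    simp only [lamstar, z, hq, marginalCost, hcast, hcast', Nat.add_sub_cancel,
      show m + 2 - 1 = m + 1 from rfl]
    ring
  have hargmin : argmin = costMinimizers m := by
    funext lam
    simp only [argmin, costMinimizers, penalizedCost, hcast, hcast',
      show m + 2 - 1 = m + 1 from rfl]
  have hmarg : ∀ y : ℝ, ((m + 2 : ℕ) : ℝ) * (((m + 2 : ℕ) : ℝ) - 1) * y ^ (m + 2 - 2) * (y - 1) =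
      marginalCost m y := fun y => by
    simp only [marginalCost, hcast, hcast', Nat.add_sub_cancel]
  clear_value z qstar lamstar AC argmin
  subst hq hAC hlamstar hargmin
  refine ⟨⟨mem_image_of_mem _ ⟨critQuantile_nonneg m, (critQuantile_lt_one m).le⟩, ?_⟩, fun lam =>
    ⟨costMinimizers_of_lt, ?_, fun hlam hneg => ?_, costMinimizers_of_nonneg⟩⟩
  · rintro _ ⟨y, hy, rfl⟩
    exact averageCost_critQuantile_le m hy.1
  · rintro rfl
    exact costMinimizers_averageCost_critQuantile m
  · simp only [hmarg]
    obtain ⟨F, hF⟩ := costMinimizers_nonempty m lam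
    obtain ⟨hFq, hFm⟩ := mem_Ioo_of_mem_costMinimizers hlam hneg hF
    have huniq : ∀ y ∈ Ioo (critQuantile m) 1, marginalCost m y = lam → y = F := fun y hy hym =>
      (strictMonoOn_marginalCost m).injOn hy.1.le hFq.1.le (hym.trans hFm.symm)
    refine ⟨F, ⟨hFq, hFm, ?_⟩, fun y hy => huniq y hy.1 hy.2.1⟩
    refine (costMinimizers_nonempty m lam).subset_singleton_iff.1 fun y hy => ?_
    obtain ⟨hyq, hym⟩ := mem_Ioo_of_mem_costMinimizers hlam hneg hy
    exact huniq y hyq hym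
end

section
/- Define p(r) := (v̄ − m)/(v̄ − r) and g(r) := r − (r − c)·p(r)^n + (v̄ − r)·(1 − n·p(r)^{n−1} + (n−1)·p(r)^n), which equals the expected revenue R(δ_{r,v̄}, r) of the second-price auction with reserve r against the two-point distribution δ_{r,v̄} on {r, v̄} with mean m. Then g is strictly decreasing on the interval [c, m). -/
open MeasureTheory Set Filter

/-- Integrating a step function that vanishes from `b` on. -/
lemma integral_Ioi_ite_lt {a b C : ℝ} (hab : a ≤ b) :
    ∫ v in Set.Ioi a, (if v < b then C else 0) = (b - a) * C := by
  have h : (fun v : ℝ => if v < b then C else 0) = (Set.Iio b).indicator fun _ => C := by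
    ext v
    simp [Set.indicator_apply]
  rw [h, setIntegral_indicator measurableSet_Iio, Set.Ioi_inter_Iio]
  simp [hab]

/-- The revenue against a two-point distribution, as a function of the mass `x` of its lower
atom, is strictly decreasing once `x` is at least `d / A`. -/
lemma strictAntiOn_revenue_in_mass (k : ℕ) {A d : ℝ} (hd : 0 < d) (hA : 0 < A) :
    StrictAntiOn (fun x : ℝ => -A * x ^ (k + 2) + (k + 2) * d * (x ^ (k + 1) - x ^ k))
      (Set.Icc (d / A) 1) := by
  refine strictAntiOn_of_deriv_neg (convex_Icc _ _) (by fun_prop) fun x hx => ?_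
  rw [interior_Icc] at hx
  obtain ⟨hx1, hx2⟩ := hx
  have hx0 : 0 < x := (div_pos hd hA).trans hx1
  rw [div_lt_iff₀ hA] at hx1
  have hderiv : HasDerivAt
      (fun x : ℝ => -A * x ^ (k + 2) + (k + 2) * d * (x ^ (k + 1) - x ^ k))
      (-A * (((k + 2 : ℕ) : ℝ) * x ^ (k + 1)) +
        (k + 2) * d * (((k + 1 : ℕ) : ℝ) * x ^ k - (k : ℝ) * x ^ (k - 1))) x :=
    ((hasDerivAt_pow (k + 2) x).const_mul (-A)).add
      (((hasDerivAt_pow (k + 1) x).sub (hasDerivAt_pow k x)).const_mul _)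
  rw [hderiv.deriv]
  have hfactor : -A * (((k + 2 : ℕ) : ℝ) * x ^ (k + 1)) +
      (k + 2) * d * (((k + 1 : ℕ) : ℝ) * x ^ k - (k : ℝ) * x ^ (k - 1)) =
      (k + 2) * (x ^ k * (d - x * A) - d * (k * x ^ (k - 1) * (1 - x))) := by
    cases k with
    | zero => simp; ring
    | succ j => simp only [Nat.add_sub_cancel]; push_cast; ring
  rw [hfactor]
  have h1 : x ^ k * (d - x * A) < 0 := mul_neg_of_pos_of_neg (by positivity) (by linarith)
  have h2 : 0 ≤ d * (k * x ^ (k - 1) * (1 - x)) :=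
    mul_nonneg hd.le (mul_nonneg (by positivity) (by linarith))
  exact mul_neg_of_pos_of_neg (by positivity) (by linarith)

theorem threat_revenue_strictly_decreasing
    (n : ℕ) (hn : 2 ≤ n) (c m vbar : ℝ)
    (hc : 0 ≤ c) (hcm : c < m) (hmv : m < vbar) :
    let p : ℝ → ℝ := fun r => (vbar - m) / (vbar - r)
    let g : ℝ → ℝ := fun r => r - (r - c) * p r ^ n +
      (vbar - r) * (1 - (n : ℝ) * p r ^ (n - 1) + ((n : ℝ) - 1) * p r ^ n)
    -- cdf of the two-point distribution on {r, vbar} with mean m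
    let δ : ℝ → ℝ → ℝ := fun r v => if v < r then 0 else if v < vbar then p r else 1
    (∀ r ∈ Set.Ico c m, g r = revenue n c (δ r) r) ∧
      StrictAntiOn g (Set.Ico c m) := by
  intro p g δ
  constructor
  · rintro r ⟨-, hrm⟩
    have hr : r < vbar := hrm.trans hmv
    have hδr : δ r r = p r := by simp [δ, hr]
    have hint : ∫ v in Set.Ioi r, (1 - (n : ℝ) * δ r v ^ (n - 1) + ((n : ℝ) - 1) * δ r v ^ n) =
        (vbar - r) * (1 - (n : ℝ) * p r ^ (n - 1) + ((n : ℝ) - 1) * p r ^ n) := by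
      rw [← integral_Ioi_ite_lt hr.le]
      refine setIntegral_congr_fun measurableSet_Ioi fun v hv => ?_
      have hv' : ¬ v < r := not_lt.mpr (le_of_lt hv)
      by_cases h : v < vbar <;> simp [δ, hv', h]
    simp only [revenue, hδr, hint, g]
  · obtain ⟨k, rfl⟩ := Nat.exists_eq_add_of_le' hn
    have hd : 0 < vbar - m := sub_pos.mpr hmv
    have hA : 0 < vbar - c := by linarith
    have hg : ∀ r < m, g r = vbar + (-(vbar - c) * p r ^ (k + 2) +
        (k + 2) * (vbar - m) * (p r ^ (k + 1) - p r ^ k)) := by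
      intro r hr
      have hp : (vbar - r) * p r = vbar - m := mul_div_cancel₀ _ (by linarith)
      simp only [g, Nat.add_succ_sub_one]
      rw [← hp]
      push_cast
      ring
    have hp_mem : ∀ r ∈ Set.Ico c m, p r ∈ Set.Icc ((vbar - m) / (vbar - c)) 1 := by
      rintro r ⟨hcr, hrm⟩
      have hr : 0 < vbar - r := by linarith
      exact ⟨div_le_div_of_nonneg_left hd.le hr (by linarith),
        (div_le_one hr).mpr (by linarith)⟩
    intro r hr s hs hrs
    have hp_lt : p r < p s :=
      div_lt_div_of_pos_left hd (by linarith [hs.2]) (by linarith)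
    rw [hg r hr.2, hg s hs.2]
    exact (add_lt_add_iff_left _).mpr
      (strictAntiOn_revenue_in_mass k hd hA (hp_mem r hr) (hp_mem s hs) hp_lt)
end

section
/- Suppose vmin* < c. Define p(r) := (v̄ − m)/(v̄ − r) and h(r) := r + (v̄ − r)·(1 − n·p(r)^{n−1} + (n−1)·p(r)^n) (the expected revenue of a second-price auction with reserve r against the two-point distribution on {r, v̄} with mean m when a sale at price r also occurs in the tie event where all values equal r). Then h is strictly increasing on the interval [vmin*, c). -/
open Set

/-- The lowest point `vmin*` of the support of the worst-case distribution. -/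
noncomputable def vminStar (n : ℕ) (m vbar : ℝ) : ℝ :=
  if n = 2 then 0 else max (m - (vbar - m) / (((n : ℝ) - 1) ^ 2 - 1)) 0

/-- The polynomial `(k + 1) q ^ (k + 1) - (k + 2) q ^ k` is strictly increasing to the right of
its critical point `1 - 1 / (k + 1) ^ 2`. -/
theorem strictMonoOn_mul_pow_succ_sub_mul_pow (k : ℕ) :
    StrictMonoOn (fun q : ℝ => ((k : ℝ) + 1) * q ^ (k + 1) - ((k : ℝ) + 2) * q ^ k)
      (Ici (1 - 1 / ((k : ℝ) + 1) ^ 2)) := by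
  apply strictMonoOn_of_deriv_pos (convex_Ici _) (by fun_prop)
  intro x hx
  rw [interior_Ici, mem_Ioi] at hx
  have hk : (0 : ℝ) ≤ k := k.cast_nonneg
  have hx0 : 0 < x := by
    refine lt_of_le_of_lt ?_ hx
    rw [sub_nonneg, div_le_one (by positivity)]
    nlinarith
  have hd : HasDerivAt (fun q : ℝ => ((k : ℝ) + 1) * q ^ (k + 1) - ((k : ℝ) + 2) * q ^ k)
      (((k : ℝ) + 1) * (((k + 1 : ℕ) : ℝ) * x ^ k) - ((k : ℝ) + 2) * ((k : ℝ) * x ^ (k - 1))) x :=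
    ((hasDerivAt_pow (k + 1) x).const_mul _).sub ((hasDerivAt_pow k x).const_mul _)
  rw [hd.deriv]
  have hcrit : ((k : ℝ) + 2) * k < ((k : ℝ) + 1) ^ 2 * x := by
    have h2 : (0 : ℝ) < ((k : ℝ) + 1) ^ 2 := by positivity
    have h3 := mul_lt_mul_of_pos_left hx h2
    rw [mul_sub, mul_one_div_cancel h2.ne'] at h3
    linarith
  rcases k with _ | j
  · simp
  · have hj : 0 < x ^ j := by positivity
    have h4 := mul_lt_mul_of_pos_right hcrit hj
    push_cast at h4 ⊢
    simp only [pow_succ x j]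
    linarith

/-- Above `vmin*` the mass at `vbar` is at least the critical point `1 - 1 / (n - 1) ^ 2`. -/
theorem one_sub_le_div_of_vminStar_le {k : ℕ} {m vbar r : ℝ} (hmv : m < vbar) (hrm : r < m)
    (hr : vminStar (k + 2) m vbar ≤ r) :
    1 - 1 / ((k : ℝ) + 1) ^ 2 ≤ (vbar - m) / (vbar - r) := by
  rcases k with _ | j
  · simpa using div_nonneg (sub_nonneg.2 hmv.le) (by linarith : 0 ≤ vbar - r)
  · rw [vminStar, if_neg (by omega)] at hr
    have h1 := (le_max_left _ _).trans hr
    have hj : (0 : ℝ) ≤ j := j.cast_nonneg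
    push_cast at h1 ⊢
    have hN : (0 : ℝ) < ((j : ℝ) + 1 + 2 - 1) ^ 2 - 1 := by nlinarith
    rw [sub_le_comm, le_div_iff₀ hN] at h1
    have hM : (0 : ℝ) < ((j : ℝ) + 1 + 1) ^ 2 := by positivity
    rw [le_div_iff₀ (by linarith), one_sub_div hM.ne', div_mul_eq_mul_div, div_le_iff₀ hM]
    linarith

theorem threat_revenue_strictly_increasing_below_c
    (n : ℕ) (hn : 2 ≤ n) (c m vbar : ℝ)
    (hc : 0 ≤ c) (hcm : c < m) (hmv : m < vbar)
    (hlt : vminStar n m vbar < c) :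
    let p : ℝ → ℝ := fun r => (vbar - m) / (vbar - r)
    let h : ℝ → ℝ := fun r => r +
      (vbar - r) * (1 - (n : ℝ) * p r ^ (n - 1) + ((n : ℝ) - 1) * p r ^ n)
    StrictMonoOn h (Set.Ico (vminStar n m vbar) c) := by
  intro p h
  obtain ⟨k, rfl⟩ := Nat.exists_eq_add_of_le' hn
  have hh : ∀ r < c, h r =
      vbar + (vbar - m) * (((k : ℝ) + 1) * p r ^ (k + 1) - ((k : ℝ) + 2) * p r ^ k) := by
    intro r hr
    have hp : (vbar - r) * p r = vbar - m := mul_div_cancel₀ _ (by linarith)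
    have hk : k + 2 - 1 = k + 1 := rfl
    simp only [h, hk]
    push_cast
    rw [← hp]
    ring
  intro a ha b hb hab
  rw [hh a ha.2, hh b hb.2]
  have hpab : p a < p b :=
    div_lt_div_of_pos_left (by linarith) (by linarith [hb.2]) (by linarith)
  have hG := strictMonoOn_mul_pow_succ_sub_mul_pow k
    (one_sub_le_div_of_vminStar_le hmv (ha.2.trans hcm) ha.1)
    (one_sub_le_div_of_vminStar_le hmv (hb.2.trans hcm) hb.1) hpab
  have := mul_lt_mul_of_pos_left hG (sub_pos.2 hmv)
  simpa using this
end

section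
/- The function φ is well defined on [q*_n, 1) (its denominator is strictly positive there), satisfies φ(q) > 1 for all q ∈ [q*_n, 1), is strictly increasing on [q*_n, 1), and φ(q) → +∞ as q → 1⁻. -/
open Set Filter
open intervalIntegral

/-- Strict Cauchy–Schwarz inequality against the constant function `1`. -/
theorem sq_integral_lt_mul_integral_sq {g : ℝ → ℝ} {a b : ℝ} (hg : Continuous g) (hab : a < b)
    (hne : g a ≠ g b) :
    (∫ y in a..b, g y) ^ 2 < (b - a) * ∫ y in a..b, g y ^ 2 := by
  have hL : 0 < b - a := sub_pos.2 hab
  set B := ∫ y in a..b, g y with hB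
  set c := B / (b - a) with hc
  have hpos : 0 < ∫ y in a..b, (g y - c) ^ 2 := by
    refine integral_pos hab (by fun_prop) (fun x _ => sq_nonneg _) ?_
    by_cases h : g a = c
    · exact ⟨b, right_mem_Icc.2 hab.le, sq_pos_of_ne_zero (fun h' => hne (by linarith))⟩
    · exact ⟨a, left_mem_Icc.2 hab.le, sq_pos_of_ne_zero (sub_ne_zero.2 h)⟩
  have hexp : ∫ y in a..b, (g y - c) ^ 2 = (∫ y in a..b, g y ^ 2) - 2 * c * B + c ^ 2 * (b - a) := by
    have h : ∀ y, (g y - c) ^ 2 = g y ^ 2 - 2 * c * g y + c ^ 2 := fun y => by ring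
    simp_rw [h]
    rw [integral_add, integral_sub, integral_const_mul, integral_const, smul_eq_mul,
      mul_comm (b - a)]
    all_goals exact Continuous.intervalIntegrable (by fun_prop) _ _
  have hcB : c * (b - a) = B := div_mul_cancel₀ _ hL.ne'
  rw [hexp] at hpos
  have := mul_pos hL hpos
  rw [← hcB] at this ⊢
  linarith

theorem hasDerivAt_integral_sub_self {f : ℝ → ℝ} {f' q b : ℝ} (hf : Continuous f)
    (hf' : HasDerivAt f f' q) :
    HasDerivAt (fun t => ∫ y in t..b, (f y - f t)) (-(f' * (b - q))) q := by
  have hI : (fun t => ∫ y in t..b, (f y - f t)) = fun t => (∫ y in t..b, f y) - f t * (b - t) := by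
    funext t
    rw [integral_sub (hf.intervalIntegrable _ _) (by simp), integral_const, smul_eq_mul,
      mul_comm (b - t)]
  rw [hI]
  have hB : HasDerivAt (fun t => ∫ y in t..b, f y) (-f q) q :=
    integral_hasDerivAt_left (hf.intervalIntegrable _ _)
      (hf.stronglyMeasurableAtFilter _ _) hf.continuousAt
  exact (hB.sub (hf'.mul ((hasDerivAt_id q).const_sub b))).congr_deriv (by simp)

theorem hasDerivAt_integral_sub_self_sq {f : ℝ → ℝ} {f' q b : ℝ} (hf : Continuous f)
    (hf' : HasDerivAt f f' q) :
    HasDerivAt (fun t => ∫ y in t..b, (f y - f t) ^ 2)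
      (-(2 * f' * ∫ y in q..b, (f y - f q))) q := by
  have hI : (fun t => ∫ y in t..b, (f y - f t) ^ 2) =
      fun t => (∫ y in t..b, f y ^ 2) - 2 * f t * (∫ y in t..b, f y) + f t ^ 2 * (b - t) := by
    funext t
    have h : ∀ y, (f y - f t) ^ 2 = f y ^ 2 - 2 * f t * f y + f t ^ 2 := fun y => by ring
    simp_rw [h]
    rw [integral_add, integral_sub, integral_const_mul, integral_const, smul_eq_mul,
      mul_comm (b - t)]
    all_goals exact Continuous.intervalIntegrable (by fun_prop) _ _
  rw [hI, integral_sub (hf.intervalIntegrable _ _) (by simp), integral_const, smul_eq_mul]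
  have hB : HasDerivAt (fun t => ∫ y in t..b, f y) (-f q) q :=
    integral_hasDerivAt_left (hf.intervalIntegrable _ _)
      (hf.stronglyMeasurableAtFilter _ _) hf.continuousAt
  have hf2 : Continuous fun y => f y ^ 2 := hf.pow 2
  have hA : HasDerivAt (fun t => ∫ y in t..b, f y ^ 2) (-(f q ^ 2)) q :=
    integral_hasDerivAt_left (hf2.intervalIntegrable _ _)
      (hf2.stronglyMeasurableAtFilter _ _) hf2.continuousAt
  exact ((hA.sub ((hf'.const_mul 2).mul hB)).add
    ((hf'.pow 2).mul ((hasDerivAt_id q).const_sub b))).congr_deriv (by simp; ring)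

theorem integral_sub_self_pos {f : ℝ → ℝ} {q b : ℝ} (hf : Continuous f) (hq : q < b)
    (hmono : StrictMonoOn f (Icc q b)) : 0 < ∫ y in q..b, (f y - f q) :=
  integral_pos hq (by fun_prop)
    (fun _ hx => sub_nonneg.2 <|
      hmono.monotoneOn (left_mem_Icc.2 hq.le) (Ioc_subset_Icc_self hx) hx.1.le)
    ⟨b, right_mem_Icc.2 hq.le,
      sub_pos.2 (hmono (left_mem_Icc.2 hq.le) (right_mem_Icc.2 hq.le) hq)⟩

theorem sq_integral_sub_self_lt {f : ℝ → ℝ} {q b : ℝ} (hf : Continuous f) (hq : q < b)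
    (hmono : StrictMonoOn f (Icc q b)) :
    (∫ y in q..b, (f y - f q)) ^ 2 < (b - q) * ∫ y in q..b, (f y - f q) ^ 2 := by
  refine sq_integral_lt_mul_integral_sq (g := fun y => f y - f q) (by fun_prop) hq fun h => ?_
  have := hmono (left_mem_Icc.2 hq.le) (right_mem_Icc.2 hq.le) hq
  linarith

theorem inv_lt_integral_sq_div_sq_integral {f : ℝ → ℝ} {q b : ℝ} (hf : Continuous f) (hq : q < b)
    (hmono : StrictMonoOn f (Icc q b)) :
    (b - q)⁻¹ < (∫ y in q..b, (f y - f q) ^ 2) / (∫ y in q..b, (f y - f q)) ^ 2 := by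
  have hD := integral_sub_self_pos hf hq hmono
  rw [lt_div_iff₀ (by positivity), inv_mul_lt_iff₀ (sub_pos.2 hq)]
  exact sq_integral_sub_self_lt hf hq hmono

theorem strictMonoOn_integral_sq_div_sq_integral {f f' : ℝ → ℝ} {a b : ℝ}
    (hf : ∀ x, HasDerivAt f (f' x) x) (hpos : ∀ x ∈ Ioo a b, 0 < f' x)
    (hmono : StrictMonoOn f (Icc a b)) :
    StrictMonoOn (fun q => (∫ y in q..b, (f y - f q) ^ 2) / (∫ y in q..b, (f y - f q)) ^ 2)
      (Ico a b) := by
  have hcont : Continuous f := continuous_iff_continuousAt.2 fun x => (hf x).continuousAt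
  have hmono' : ∀ q ∈ Ico a b, StrictMonoOn f (Icc q b) := fun q hq =>
    hmono.mono (Icc_subset_Icc_left hq.1)
  have hder : ∀ q ∈ Ico a b, HasDerivAt
      (fun q => (∫ y in q..b, (f y - f q) ^ 2) / (∫ y in q..b, (f y - f q)) ^ 2) _ q :=
    fun q hq => (hasDerivAt_integral_sub_self_sq hcont (hf q)).div
      ((hasDerivAt_integral_sub_self hcont (hf q)).pow 2)
      (pow_ne_zero 2 (integral_sub_self_pos hcont hq.2 (hmono' q hq)).ne')
  refine strictMonoOn_of_deriv_pos (convex_Ico a b)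
    (fun q hq => (hder q hq).continuousAt.continuousWithinAt) fun q hq => ?_
  rw [interior_Ico] at hq
  have hq' := Ioo_subset_Ico_self hq
  rw [(hder q hq').deriv]
  have hD := integral_sub_self_pos hcont hq.2 (hmono' q hq')
  have hCS := sq_integral_sub_self_lt hcont hq.2 (hmono' q hq')
  set D := ∫ y in q..b, (f y - f q)
  set N := ∫ y in q..b, (f y - f q) ^ 2
  refine div_pos ?_ (by positivity)
  have := mul_pos (mul_pos (mul_pos two_pos hD) (hpos q hq)) (sub_pos.2 hCS)
  push_cast
  linarith

theorem tendsto_integral_sq_div_sq_integral {f : ℝ → ℝ} {a b : ℝ} (hab : a < b)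
    (hf : Continuous f) (hmono : StrictMonoOn f (Icc a b)) :
    Tendsto (fun q => (∫ y in q..b, (f y - f q) ^ 2) / (∫ y in q..b, (f y - f q)) ^ 2)
      (nhdsWithin b (Iio b)) atTop := by
  have hinv : Tendsto (fun q => (b - q)⁻¹) (nhdsWithin b (Iio b)) atTop := by
    refine tendsto_inv_nhdsGT_zero.comp (tendsto_nhdsWithin_iff.2 ⟨?_, ?_⟩)
    · have : Tendsto (fun q => b - q) (nhds b) (nhds (b - b)) :=
        Continuous.tendsto (by fun_prop) b
      rw [sub_self] at this
      exact this.mono_left nhdsWithin_le_nhds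
    · filter_upwards [self_mem_nhdsWithin] with q hq using sub_pos.2 (mem_Iio.1 hq)
  refine tendsto_atTop_mono' _ ?_ hinv
  filter_upwards [Ioo_mem_nhdsLT hab] with q hq
  exact (inv_lt_integral_sq_div_sq_integral hf hq.2
    (hmono.mono (Icc_subset_Icc_left hq.1.le))).le

theorem deriv_pow_succ_sub_pow_pos (m : ℕ) {y : ℝ} (hy : 1 - 1 / ((m : ℝ) + 1) ^ 2 < y) :
    0 < ((m : ℝ) + 1) * y ^ m - m * y ^ (m - 1) := by
  rcases m with _ | k
  · simp
  · push_cast at hy ⊢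
    have hk : (0 : ℝ) ≤ k := k.cast_nonneg
    have hle : 1 / ((k : ℝ) + 1 + 1) ^ 2 ≤ 1 / ((k : ℝ) + 1 + 1) :=
      one_div_le_one_div_of_le (by positivity) (by nlinarith)
    have hlt : 1 / ((k : ℝ) + 1 + 1) < 1 := by
      rw [div_lt_one (by positivity)]; linarith
    have hy0 : 0 < y := by linarith
    have hlin : 0 < ((k : ℝ) + 1 + 1) * y - (k + 1) := by
      have h := mul_lt_mul_of_pos_left (show 1 - 1 / ((k : ℝ) + 1 + 1) < y by linarith)
        (show (0 : ℝ) < k + 1 + 1 by positivity)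
      rw [mul_sub, mul_one_div_cancel (by positivity)] at h
      linarith
    have := mul_pos (pow_pos hy0 k) hlin
    rw [pow_succ]
    linarith

theorem phi_properties (n : ℕ) (hn : 2 ≤ n) :
    let z : ℝ → ℝ := fun y => y ^ (n - 1) - y ^ (n - 2)
    let qstar : ℝ := 1 - 1 / ((n : ℝ) - 1) ^ 2
    let φ : ℝ → ℝ := fun q =>
      (∫ y in q..1, (z y - z q) ^ 2) / (∫ y in q..1, (z y - z q)) ^ 2
    (∀ q ∈ Set.Ico qstar 1, 0 < (∫ y in q..1, (z y - z q)) ^ 2) ∧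
    (∀ q ∈ Set.Ico qstar 1, 1 < φ q) ∧
    StrictMonoOn φ (Set.Ico qstar 1) ∧
    Filter.Tendsto φ (nhdsWithin 1 (Set.Iio 1)) Filter.atTop := by
  intro z qstar φ
  obtain ⟨m, rfl⟩ := Nat.exists_eq_add_of_le' hn
  have hqstar : qstar = 1 - 1 / ((m : ℝ) + 1) ^ 2 := by
    simp only [qstar]; push_cast; ring
  have hz : ∀ y, HasDerivAt z (((m : ℝ) + 1) * y ^ m - m * y ^ (m - 1)) y := fun y => by
    exact ((hasDerivAt_pow (m + 1) y).sub (hasDerivAt_pow m y)).congr_deriv (by simp)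
  have hcont : Continuous z := by fun_prop
  have hpos : ∀ y ∈ Ioo qstar 1, 0 < ((m : ℝ) + 1) * y ^ m - m * y ^ (m - 1) := fun y hy =>
    deriv_pow_succ_sub_pow_pos m (hqstar ▸ hy.1)
  have hmono : StrictMonoOn z (Icc qstar 1) := by
    refine strictMonoOn_of_deriv_pos (convex_Icc _ _) hcont.continuousOn fun y hy => ?_
    rw [interior_Icc] at hy
    rw [(hz y).deriv]
    exact hpos y hy
  have hmono' : ∀ q ∈ Ico qstar 1, StrictMonoOn z (Icc q 1) := fun q hq =>
    hmono.mono (Icc_subset_Icc_left hq.1)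
  have hlt : qstar < 1 := by
    rw [hqstar]
    exact sub_lt_self _ (by positivity)
  have hnonneg : 0 ≤ qstar := by
    rw [hqstar, sub_nonneg]
    exact div_le_one_of_le₀ (one_le_pow₀ (by simp)) (by positivity)
  refine ⟨fun q hq => pow_pos (integral_sub_self_pos hcont hq.2 (hmono' q hq)) 2,
    fun q hq => ?_, strictMonoOn_integral_sq_div_sq_integral hz hpos hmono,
    tendsto_integral_sq_div_sq_integral hlt hcont hmono⟩
  have h1 : 1 ≤ (1 - q)⁻¹ := (one_le_inv₀ (sub_pos.2 hq.2)).2 (by linarith [hq.1])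
  exact h1.trans_lt (inv_lt_integral_sq_div_sq_integral hcont hq.2 (hmono' q hq))
end

section
/- For every ρ ∈ [vmin**, m) there exists exactly one triple (λ₁, λ₂, q) with λ₂ > 0 and q ∈ [q*_n, 1) satisfying the system: (i) λ₁ + 2λ₂·ρ = n(n−1)·z(q); (ii) n(n−1)·∫_q^1 (z(y) − z(q)) dy = 2λ₂·(m − ρ); (iii) n²(n−1)²·∫_q^1 (z(y) − z(q))² dy = 4λ₂²·((m − ρ)² + σ²). Moreover this triple satisfies λ₁ < 0, and its q-component is the unique q ∈ [q*_n, 1) with φ(q) = 1 + σ²/(m − ρ)². -/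
open Set Filter

/-- `z(y) = y^{n-1} - y^{n-2}`. -/
noncomputable def zfun (n : ℕ) (y : ℝ) : ℝ := y ^ (n - 1) - y ^ (n - 2)

/-- `q*_n = 1 - 1/(n-1)²`. -/
noncomputable def qstar (n : ℕ) : ℝ := 1 - 1 / ((n : ℝ) - 1) ^ 2

/-- `φ(q)` from the construction of the worst-case distributions. -/
noncomputable def phi (n : ℕ) (q : ℝ) : ℝ :=
  (∫ y in q..1, (zfun n y - zfun n q) ^ 2) / (∫ y in q..1, (zfun n y - zfun n q)) ^ 2

/-- The lowest point `vmin**` of the support of the worst-case distribution. -/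
noncomputable def vminSS (n : ℕ) (m σ : ℝ) : ℝ :=
  max (m - σ / Real.sqrt (phi n (qstar n) - 1)) 0

@[fun_prop]
theorem continuous_zfun (n : ℕ) : Continuous (zfun n) := by
  unfold zfun; fun_prop

theorem qstar_nonneg {n : ℕ} (hn : 2 ≤ n) : 0 ≤ qstar n := by
  have h : (2 : ℝ) ≤ n := by exact_mod_cast hn
  have : 1 / ((n : ℝ) - 1) ^ 2 ≤ 1 := by
    rw [div_le_one (by nlinarith)]
    nlinarith
  unfold qstar
  linarith

theorem qstar_lt_one {n : ℕ} (hn : 2 ≤ n) : qstar n < 1 := by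
  have h : (2 : ℝ) ≤ n := by exact_mod_cast hn
  have : 0 < 1 / ((n : ℝ) - 1) ^ 2 := div_pos one_pos (by nlinarith)
  unfold qstar
  linarith

theorem exists_hasDerivAt_zfun_pos {n : ℕ} (hn : 2 ≤ n) {y : ℝ} (hy : qstar n < y) :
    ∃ z', 0 < z' ∧ HasDerivAt (zfun n) z' y := by
  have hy0 : 0 < y := (qstar_nonneg hn).trans_lt hy
  obtain ⟨k, rfl⟩ := Nat.exists_eq_add_of_le' hn
  have h1 : (k : ℝ) < (k + 1) * y := by
    have hk : (0 : ℝ) < k + 1 := by positivity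
    have e : qstar (k + 2) = 1 - 1 / ((k : ℝ) + 1) ^ 2 := by
      unfold qstar
      push_cast
      ring
    rw [e] at hy
    have h2 := mul_lt_mul_of_pos_left hy hk
    have h3 : ((k : ℝ) + 1) * (1 - 1 / (k + 1) ^ 2) = k + 1 - 1 / (k + 1) := by
      field_simp
    have h4 : 1 / ((k : ℝ) + 1) ≤ 1 := by
      rw [div_le_one hk]
      linarith [(Nat.cast_nonneg k : (0 : ℝ) ≤ k)]
    linarith
  refine ⟨_, ?_, (hasDerivAt_pow (k + 1) y).sub (hasDerivAt_pow k y)⟩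
  rcases k with _ | k
  · simp
  · have e : ((k + 1 + 1 : ℕ) : ℝ) * y ^ (k + 1 + 1 - 1) - ((k + 1 : ℕ) : ℝ) * y ^ (k + 1 - 1) =
        y ^ k * (((k + 1 : ℕ) + 1) * y - (k + 1 : ℕ)) := by
      push_cast
      ring
    rw [e]
    exact mul_pos (pow_pos hy0 k) (by linarith)

theorem strictMonoOn_zfun {n : ℕ} (hn : 2 ≤ n) : StrictMonoOn (zfun n) (Ici (qstar n)) := by
  refine strictMonoOn_of_deriv_pos (convex_Ici _) (continuous_zfun n).continuousOn fun y hy => ?_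
  rw [interior_Ici] at hy
  obtain ⟨z', hpos, hd⟩ := exists_hasDerivAt_zfun_pos hn hy
  rwa [hd.deriv]

theorem zfun_neg {n : ℕ} (hn : 2 ≤ n) {q : ℝ} (hq : q ∈ Ico (qstar n) 1) : zfun n q < 0 := by
  have h := strictMonoOn_zfun hn hq.1 (mem_Ici.2 (hq.1.trans hq.2.le)) hq.2
  have h1 : zfun n 1 = 0 := by simp [zfun]
  linarith

theorem integral_zfun_sub_pos {n : ℕ} (hn : 2 ≤ n) {q : ℝ} (hq : q ∈ Ico (qstar n) 1) :
    0 < ∫ y in q..1, (zfun n y - zfun n q) := by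
  have hm := strictMonoOn_zfun hn
  refine intervalIntegral.integral_pos hq.2
    ((continuous_zfun n).sub continuous_const).continuousOn (fun y hy => ?_)
    ⟨1, right_mem_Icc.2 hq.2.le, ?_⟩
  · exact sub_nonneg.2 (hm hq.1 (mem_Ici.2 (hq.1.trans hy.1.le)) hy.1).le
  · exact sub_pos.2 (hm hq.1 (mem_Ici.2 (hq.1.trans hq.2.le)) hq.2)

theorem sq_integral_zfun_sub_lt {n : ℕ} (hn : 2 ≤ n) {q : ℝ} (hq : q ∈ Ico (qstar n) 1) :
    (∫ y in q..1, (zfun n y - zfun n q)) ^ 2 <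
      (1 - q) * ∫ y in q..1, (zfun n y - zfun n q) ^ 2 := by
  have hB := integral_zfun_sub_pos hn hq
  have hw : Continuous fun y => zfun n y - zfun n q := (continuous_zfun n).sub continuous_const
  have hd : 0 < 1 - q := sub_pos.2 hq.2
  set B := ∫ y in q..1, (zfun n y - zfun n q) with hBdef
  set c := B / (1 - q) with hc
  have hpos : 0 < ∫ y in q..1, (zfun n y - zfun n q - c) ^ 2 := by
    refine intervalIntegral.integral_pos hq.2 (by fun_prop) (fun y _ => sq_nonneg _)
      ⟨q, left_mem_Icc.2 hq.2.le, ?_⟩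
    have : 0 < c := div_pos hB hd
    rw [sub_self, zero_sub, neg_sq]
    positivity
  have e : ∫ y in q..1, (zfun n y - zfun n q - c) ^ 2 =
      (∫ y in q..1, (zfun n y - zfun n q) ^ 2) - 2 * c * B + (1 - q) * c ^ 2 := by
    have : ∀ y, (zfun n y - zfun n q - c) ^ 2 =
        (zfun n y - zfun n q) ^ 2 - 2 * c * (zfun n y - zfun n q) + c ^ 2 := fun y => by ring
    simp_rw [this]
    rw [intervalIntegral.integral_add, intervalIntegral.integral_sub,
      intervalIntegral.integral_const_mul, intervalIntegral.integral_const, smul_eq_mul]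
    all_goals exact Continuous.intervalIntegrable (by fun_prop) _ _
  rw [e] at hpos
  have hcB : B = c * (1 - q) := by rw [hc]; field_simp
  have := mul_pos hd hpos
  rw [hcB] at this ⊢
  nlinarith

theorem one_lt_one_sub_mul_phi {n : ℕ} (hn : 2 ≤ n) {q : ℝ} (hq : q ∈ Ico (qstar n) 1) :
    1 < (1 - q) * phi n q := by
  have hB := integral_zfun_sub_pos hn hq
  unfold phi
  rw [← mul_div_assoc, one_lt_div (by positivity)]
  exact sq_integral_zfun_sub_lt hn hq

theorem hasDerivAt_integral_zfun_sub {n : ℕ} {q z' : ℝ} (hz : HasDerivAt (zfun n) z' q) :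
    HasDerivAt (fun q => ∫ y in q..1, (zfun n y - zfun n q)) (-(z' * (1 - q))) q := by
  have hc := continuous_zfun n
  have e : (fun q => ∫ y in q..1, (zfun n y - zfun n q)) =
      fun q => (∫ y in q..1, zfun n y) - (1 - q) * zfun n q := by
    funext q
    rw [intervalIntegral.integral_sub (hc.intervalIntegrable _ _) (by simp),
      intervalIntegral.integral_const, smul_eq_mul]
  have h1 : HasDerivAt (fun q => ∫ y in q..1, zfun n y) (-zfun n q) q :=
    intervalIntegral.integral_hasDerivAt_left (hc.intervalIntegrable _ _)
      hc.aestronglyMeasurable.stronglyMeasurableAtFilter hc.continuousAt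
  rw [e]
  refine (h1.sub (((hasDerivAt_id' q).const_sub 1).mul hz)).congr_deriv ?_
  ring

theorem hasDerivAt_integral_zfun_sub_sq {n : ℕ} {q z' : ℝ} (hz : HasDerivAt (zfun n) z' q) :
    HasDerivAt (fun q => ∫ y in q..1, (zfun n y - zfun n q) ^ 2)
      (-(2 * z' * ∫ y in q..1, (zfun n y - zfun n q))) q := by
  have hc := continuous_zfun n
  have eB : (∫ y in q..1, (zfun n y - zfun n q)) =
      (∫ y in q..1, zfun n y) - (1 - q) * zfun n q := by
    rw [intervalIntegral.integral_sub (hc.intervalIntegrable _ _) (by simp),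
      intervalIntegral.integral_const, smul_eq_mul]
  have e : (fun q => ∫ y in q..1, (zfun n y - zfun n q) ^ 2) =
      fun q => (∫ y in q..1, zfun n y ^ 2) - 2 * zfun n q * (∫ y in q..1, zfun n y) +
        (1 - q) * zfun n q ^ 2 := by
    funext q
    have : ∀ y, (zfun n y - zfun n q) ^ 2 =
        zfun n y ^ 2 - 2 * zfun n q * zfun n y + zfun n q ^ 2 := fun y => by ring
    simp_rw [this]
    rw [intervalIntegral.integral_add, intervalIntegral.integral_sub,
      intervalIntegral.integral_const_mul, intervalIntegral.integral_const, smul_eq_mul]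
    all_goals exact Continuous.intervalIntegrable (by fun_prop) _ _
  have h1 : HasDerivAt (fun q => ∫ y in q..1, zfun n y) (-zfun n q) q :=
    intervalIntegral.integral_hasDerivAt_left (hc.intervalIntegrable _ _)
      hc.aestronglyMeasurable.stronglyMeasurableAtFilter hc.continuousAt
  have hc2 : Continuous fun y => zfun n y ^ 2 := hc.pow 2
  have h2 : HasDerivAt (fun q => ∫ y in q..1, zfun n y ^ 2) (-zfun n q ^ 2) q :=
    intervalIntegral.integral_hasDerivAt_left (hc2.intervalIntegrable _ _)
      hc2.aestronglyMeasurable.stronglyMeasurableAtFilter hc2.continuousAt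
  rw [e, eB]
  refine ((h2.sub ((hz.const_mul 2).mul h1)).add
    (((hasDerivAt_id' q).const_sub 1).mul (hz.pow 2))).congr_deriv ?_
  rw [Pi.pow_apply]
  push_cast
  ring

theorem continuousOn_phi {n : ℕ} (hn : 2 ≤ n) : ContinuousOn (phi n) (Ico (qstar n) 1) := by
  have hz : ∀ q, ∃ z', HasDerivAt (zfun n) z' q := fun q =>
    ⟨_, (hasDerivAt_pow (n - 1) q).sub (hasDerivAt_pow (n - 2) q)⟩
  intro q hq
  obtain ⟨z', hz'⟩ := hz q
  exact ((hasDerivAt_integral_zfun_sub_sq hz').continuousAt.div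
    ((hasDerivAt_integral_zfun_sub hz').continuousAt.pow 2)
    (pow_ne_zero 2 (integral_zfun_sub_pos hn hq).ne')).continuousWithinAt

theorem strictMonoOn_phi {n : ℕ} (hn : 2 ≤ n) : StrictMonoOn (phi n) (Ico (qstar n) 1) := by
  refine strictMonoOn_of_deriv_pos (convex_Ico _ _) (continuousOn_phi hn) fun q hq => ?_
  rw [interior_Ico] at hq
  have hq' : q ∈ Ico (qstar n) 1 := Ioo_subset_Ico_self hq
  obtain ⟨z', hpos, hz'⟩ := exists_hasDerivAt_zfun_pos hn hq.1
  have hB := integral_zfun_sub_pos hn hq'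
  have hCS := sq_integral_zfun_sub_lt hn hq'
  have hd : HasDerivAt (phi n) _ q := (hasDerivAt_integral_zfun_sub_sq hz').div
    ((hasDerivAt_integral_zfun_sub hz').pow 2) (pow_ne_zero 2 hB.ne')
  rw [hd.deriv]
  refine div_pos ?_ (by positivity)
  set A := ∫ y in q..1, (zfun n y - zfun n q) ^ 2
  set B := ∫ y in q..1, (zfun n y - zfun n q)
  have h := mul_pos (mul_pos (mul_pos two_pos hpos) hB) (sub_pos.2 hCS)
  push_cast
  nlinarith

theorem exists_phi_eq {n : ℕ} (hn : 2 ≤ n) {t : ℝ} (ht : phi n (qstar n) ≤ t) :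
    ∃ q ∈ Ico (qstar n) 1, phi n q = t := by
  have h0 : qstar n ∈ Ico (qstar n) 1 := left_mem_Ico.2 (qstar_lt_one hn)
  have hlt := one_lt_one_sub_mul_phi hn h0
  have hd : 0 < 1 - qstar n := sub_pos.2 h0.2
  have ht0 : 0 < t := lt_of_lt_of_le (pos_of_mul_pos_right (one_pos.trans hlt) hd.le) ht
  set q₁ := max (qstar n) (1 - 1 / t) with hq₁
  have h1 : q₁ ∈ Ico (qstar n) 1 :=
    ⟨le_max_left _ _, max_lt h0.2 (sub_lt_self _ (by positivity))⟩
  have hphi : t ≤ phi n q₁ := by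
    have hlt1 := one_lt_one_sub_mul_phi hn h1
    have hd1 : 0 < 1 - q₁ := sub_pos.2 h1.2
    have hp : 0 < phi n q₁ := pos_of_mul_pos_right (one_pos.trans hlt1) hd1.le
    have hle : 1 - q₁ ≤ 1 / t := by linarith [le_max_right (qstar n) (1 - 1 / t)]
    have h3 := hlt1.trans_le (mul_le_mul_of_nonneg_right hle hp.le)
    rw [one_div_mul_eq_div, one_lt_div ht0] at h3
    exact h3.le
  have hsub : Icc (qstar n) q₁ ⊆ Ico (qstar n) 1 := fun x hx => ⟨hx.1, hx.2.trans_lt h1.2⟩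
  obtain ⟨q, hq, he⟩ := intermediate_value_Icc h1.1 ((continuousOn_phi hn).mono hsub) ⟨ht, hphi⟩
  exact ⟨q, hsub hq, he⟩

theorem one_lt_phi {n : ℕ} (hn : 2 ≤ n) {q : ℝ} (hq : q ∈ Ico (qstar n) 1) : 1 < phi n q := by
  have h := one_lt_one_sub_mul_phi hn hq
  have hd : 0 < 1 - q := sub_pos.2 hq.2
  have hp : 0 < phi n q := pos_of_mul_pos_right (one_pos.trans h) hd.le
  nlinarith [mul_nonneg ((qstar_nonneg hn).trans hq.1) hp.le]

theorem phi_qstar_le {n : ℕ} (hn : 2 ≤ n) {m σ ρ : ℝ} (hσ : 0 < σ)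
    (hρ : ρ ∈ Ico (vminSS n m σ) m) : phi n (qstar n) ≤ 1 + σ ^ 2 / (m - ρ) ^ 2 := by
  have hp : 0 < phi n (qstar n) - 1 :=
    sub_pos.2 (one_lt_phi hn (left_mem_Ico.2 (qstar_lt_one hn)))
  have hd : 0 < m - ρ := sub_pos.2 hρ.2
  have hle : m - ρ ≤ σ / √(phi n (qstar n) - 1) := by
    have := (le_max_left _ _).trans hρ.1
    linarith
  rw [le_div_iff₀ (Real.sqrt_pos.2 hp), mul_comm, ← le_div_iff₀ hd,
    Real.sqrt_le_left (by positivity), div_pow] at hle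
  linarith

theorem phi_eq_of_moment_eqs {n : ℕ} (hn : 2 ≤ n) {q d s l : ℝ} (hd : 0 < d) (hl : 0 < l)
    (h1 : (n : ℝ) * ((n : ℝ) - 1) * (∫ y in q..1, (zfun n y - zfun n q)) = 2 * l * d)
    (h2 : (n : ℝ) ^ 2 * ((n : ℝ) - 1) ^ 2 * (∫ y in q..1, (zfun n y - zfun n q) ^ 2) =
      4 * l ^ 2 * (d ^ 2 + s ^ 2)) :
    phi n q = 1 + s ^ 2 / d ^ 2 := by
  have hn' : (2 : ℝ) ≤ n := by exact_mod_cast hn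
  have hN : 0 < (n : ℝ) * ((n : ℝ) - 1) := mul_pos (by linarith) (by linarith)
  rw [← mul_pow] at h2
  have e1 : (∫ y in q..1, (zfun n y - zfun n q)) = 2 * l * d / ((n : ℝ) * ((n : ℝ) - 1)) := by
    rw [eq_div_iff hN.ne', ← h1, mul_comm]
  have e2 : (∫ y in q..1, (zfun n y - zfun n q) ^ 2) =
      4 * l ^ 2 * (d ^ 2 + s ^ 2) / ((n : ℝ) * ((n : ℝ) - 1)) ^ 2 := by
    rw [eq_div_iff (pow_pos hN 2).ne', ← h2, mul_comm]
  unfold phi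
  rw [e1, e2]
  generalize (n : ℝ) * ((n : ℝ) - 1) = N at hN
  field_simp
  ring

theorem unique_lagrange_triple
    (n : ℕ) (hn : 2 ≤ n) (m σ : ℝ) (hm : 0 < m) (hσ : 0 < σ)
    (ρ : ℝ) (hρ : ρ ∈ Set.Ico (vminSS n m σ) m) :
    (∃! t : ℝ × ℝ × ℝ,
      0 < t.2.1 ∧ t.2.2 ∈ Set.Ico (qstar n) 1 ∧
      t.1 + 2 * t.2.1 * ρ = (n : ℝ) * ((n : ℝ) - 1) * zfun n t.2.2 ∧
      (n : ℝ) * ((n : ℝ) - 1) * (∫ y in t.2.2..1, (zfun n y - zfun n t.2.2)) =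
        2 * t.2.1 * (m - ρ) ∧
      (n : ℝ) ^ 2 * ((n : ℝ) - 1) ^ 2 *
          (∫ y in t.2.2..1, (zfun n y - zfun n t.2.2) ^ 2) =
        4 * t.2.1 ^ 2 * ((m - ρ) ^ 2 + σ ^ 2)) ∧
    (∀ l1 l2 q : ℝ, 0 < l2 → q ∈ Set.Ico (qstar n) 1 →
      l1 + 2 * l2 * ρ = (n : ℝ) * ((n : ℝ) - 1) * zfun n q →
      (n : ℝ) * ((n : ℝ) - 1) * (∫ y in q..1, (zfun n y - zfun n q)) =
        2 * l2 * (m - ρ) →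
      (n : ℝ) ^ 2 * ((n : ℝ) - 1) ^ 2 * (∫ y in q..1, (zfun n y - zfun n q) ^ 2) =
        4 * l2 ^ 2 * ((m - ρ) ^ 2 + σ ^ 2) →
      l1 < 0 ∧ phi n q = 1 + σ ^ 2 / (m - ρ) ^ 2 ∧
        ∀ q' ∈ Set.Ico (qstar n) 1, phi n q' = 1 + σ ^ 2 / (m - ρ) ^ 2 → q' = q) := by
  have hn' : (2 : ℝ) ≤ n := by exact_mod_cast hn
  have hN : 0 < (n : ℝ) * ((n : ℝ) - 1) := mul_pos (by linarith) (by linarith)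
  have hd : 0 < m - ρ := sub_pos.2 hρ.2
  have hρ0 : 0 ≤ ρ := (le_max_right _ _).trans hρ.1
  refine ⟨?_, fun l1 l2 q hl2 hq h1 h2 h3 => ?_⟩
  · obtain ⟨q, hq, hphi⟩ := exists_phi_eq hn (phi_qstar_le hn hσ hρ)
    have hB := integral_zfun_sub_pos hn hq
    set l : ℝ := (n : ℝ) * ((n : ℝ) - 1) * (∫ y in q..1, (zfun n y - zfun n q)) /
      (2 * (m - ρ)) with hl
    have hl2 : (n : ℝ) * ((n : ℝ) - 1) * (∫ y in q..1, (zfun n y - zfun n q)) =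
        2 * l * (m - ρ) := by
      rw [hl]
      field_simp
    refine ⟨((n : ℝ) * ((n : ℝ) - 1) * zfun n q - 2 * l * ρ, l, q),
      ⟨by positivity, hq, by simp, hl2, ?_⟩, ?_⟩
    · have hA : (∫ y in q..1, (zfun n y - zfun n q) ^ 2) =
          (1 + σ ^ 2 / (m - ρ) ^ 2) * (∫ y in q..1, (zfun n y - zfun n q)) ^ 2 := by
        rw [← hphi, phi, div_mul_cancel₀ _ (by positivity)]
      calc _ = (1 + σ ^ 2 / (m - ρ) ^ 2) *
            ((n : ℝ) * ((n : ℝ) - 1) * (∫ y in q..1, (zfun n y - zfun n q))) ^ 2 := by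
              simp only [hA]
              ring
        _ = _ := by
              rw [hl2]
              field_simp
              ring
    · rintro ⟨l1, l2, q'⟩ ⟨hl2', hq', h1, h2, h3⟩
      simp only at hl2' hq' h1 h2 h3
      obtain rfl : q' = q := (strictMonoOn_phi hn).injOn hq' hq
        ((phi_eq_of_moment_eqs hn hd hl2' h2 h3).trans hphi.symm)
      obtain rfl : l2 = l := by
        rw [hl, h2]
        field_simp
      simp only [Prod.mk.injEq, and_true]
      linarith
  · have hphi := phi_eq_of_moment_eqs hn hd hl2 h2 h3
    refine ⟨?_, hphi, fun q' hq' h => (strictMonoOn_phi hn).injOn hq' hq (h.trans hphi.symm)⟩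
    have := mul_neg_of_pos_of_neg hN (zfun_neg hn hq)
    have := mul_nonneg hl2.le hρ0
    linarith
end

section
/- Suppose n ≥ 3 and (n−1)² ≥ (v̄ − c)/(m − c). Then the maxmin revenue equals m − α_n·(v̄ − m), where α_n := (n/(n−1))·(1 − 1/(n−1)²)^{n−2} − 1; that is, inf_{F ∈ Δ₁(m,v̄)} R(F,c) = m − α_n·(v̄ − m), and the infimum is attained by the two-point distribution on {vmin*, v̄} with mean m (which places probability q*_n := 1 − 1/(n−1)² on vmin* := m − (v̄ − m)/((n−1)² − 1)). -/
open MeasureTheory Set Filter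

open intervalIntegral in
/-- Integral over `[a, b₂]` of a function of a two-step function. -/
theorem integral_comp_two_step (φ : ℝ → ℝ) {a b₁ b₂ q : ℝ} (h₁ : a ≤ b₁) (h₂ : b₁ ≤ b₂) :
    ∫ v in a..b₂, φ (if v < b₁ then 0 else if v < b₂ then q else 1) =
      (b₁ - a) * φ 0 + (b₂ - b₁) * φ q := by
  set f : ℝ → ℝ := fun v => φ (if v < b₁ then 0 else if v < b₂ then q else 1) with hf
  have e₁ : EqOn f (fun _ => φ 0) (Ioo a b₁) := fun v hv => by simp [hf, hv.2]
  have e₂ : EqOn f (fun _ => φ q) (Ioo b₁ b₂) := fun v hv => by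
    simp [hf, hv.2, not_lt.2 hv.1.le]
  have i₁ : IntervalIntegrable f volume a b₁ := by
    rw [intervalIntegrable_iff_integrableOn_Ioo_of_le h₁, integrableOn_congr_fun e₁ measurableSet_Ioo]
    exact integrableOn_const (by simp)
  have i₂ : IntervalIntegrable f volume b₁ b₂ := by
    rw [intervalIntegrable_iff_integrableOn_Ioo_of_le h₂, integrableOn_congr_fun e₂ measurableSet_Ioo]
    exact integrableOn_const (by simp)
  rw [← integral_add_adjacent_intervals i₁ i₂, integral_of_le h₁, integral_of_le h₂,
    integral_Ioc_eq_integral_Ioo, integral_Ioc_eq_integral_Ioo,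
    setIntegral_congr_fun measurableSet_Ioo e₁, setIntegral_congr_fun measurableSet_Ioo e₂]
  simp [h₁, h₂]

theorem monotone_two_step {b₁ b₂ q : ℝ} (h₀ : 0 ≤ q) (h₁ : q ≤ 1) :
    Monotone (fun v : ℝ => if v < b₁ then (0 : ℝ) else if v < b₂ then q else 1) := by
  intro x y hxy
  dsimp only
  split_ifs <;> linarith

theorem continuousWithinAt_two_step (b₁ b₂ q x : ℝ) :
    ContinuousWithinAt (fun v : ℝ => if v < b₁ then (0 : ℝ) else if v < b₂ then q else 1)
      (Ici x) x := by
  have step : ∀ (b y : ℝ), ∀ᶠ v in nhdsWithin y (Ici y), (v < b ↔ y < b) := by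
    intro b y
    by_cases h : y < b
    · filter_upwards [mem_nhdsWithin_of_mem_nhds (Iio_mem_nhds h)] with v hv
      exact ⟨fun _ => h, fun _ => hv⟩
    · filter_upwards [self_mem_nhdsWithin] with v hv
      exact ⟨fun h' => lt_of_le_of_lt hv h', fun h' => absurd h' h⟩
  refine (continuousWithinAt_const (b := if x < b₁ then (0 : ℝ) else if x < b₂ then q else 1)
    ).congr_of_eventuallyEq ?_ rfl
  filter_upwards [step b₁ x, step b₂ x] with v hv₁ hv₂
  simp only [hv₁, hv₂]

theorem succ_mul_pow_le_one_add_mul_pow {x : ℝ} (hx : 0 ≤ x) (N : ℕ) :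
    ((N : ℝ) + 1) * x ^ N ≤ 1 + N * x ^ (N + 1) := by
  induction N with
  | zero => simp
  | succ N ih =>
    have h : 0 ≤ ((N : ℝ) + 1) * x ^ N * (x - 1) ^ 2 := by positivity
    push_cast
    linear_combination ih + h

/-- The line through `(0, 1)` tangent to the second-order-statistic polynomial bounds it below. -/
theorem tangent_line_le {N : ℕ} (hN : 1 ≤ N) {q : ℝ} (hq : 0 ≤ q) :
    1 - ((N : ℝ) + 2) / (N + 1) * (1 - 1 / ((N : ℝ) + 1) ^ 2) ^ N * q ≤
      1 - ((N : ℝ) + 2) * q ^ (N + 1) + (N + 1) * q ^ (N + 2) := by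
  have hN' : (1 : ℝ) ≤ N := by exact_mod_cast hN
  set s : ℝ := 1 - 1 / ((N : ℝ) + 1) ^ 2 with hs
  have hsN : s = N * (N + 2) / (N + 1) ^ 2 := by rw [hs]; field_simp; ring
  have hs0 : 0 < s := by rw [hsN]; positivity
  clear_value s
  obtain ⟨x, rfl⟩ : ∃ x, q = x * s := ⟨q / s, by field_simp⟩
  have hx : 0 ≤ x := nonneg_of_mul_nonneg_left hq hs0
  have key := mul_le_mul_of_nonneg_left (succ_mul_pow_le_one_add_mul_pow hx N)
    (show 0 ≤ ((N : ℝ) + 2) / (N + 1) * s ^ N * (x * s) by positivity)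
  have e₁ : ((N : ℝ) + 2) / (N + 1) * (N + 1) = N + 2 := by field_simp
  have e₂ : ((N : ℝ) + 2) / (N + 1) * N = (N + 1) * s := by rw [hsN]; field_simp
  have l : ((N : ℝ) + 2) / (N + 1) * s ^ N * (x * s) * ((N + 1) * x ^ N)
      = (N + 2) * (x * s) ^ (N + 1) := by
    linear_combination (s ^ N * (x * s) * x ^ N) * e₁
  have r : ((N : ℝ) + 2) / (N + 1) * s ^ N * (x * s) * (1 + N * x ^ (N + 1))
      = ((N : ℝ) + 2) / (N + 1) * s ^ N * (x * s) + (N + 1) * (x * s) ^ (N + 2) := by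
    linear_combination (s ^ N * (x * s) * x ^ (N + 1)) * e₂
  linarith

theorem tangent_line_eq {N : ℕ} {s : ℝ} (hs : s = 1 - 1 / ((N : ℝ) + 1) ^ 2) :
    1 - ((N : ℝ) + 2) * s ^ (N + 1) + (N + 1) * s ^ (N + 2) =
      1 - ((N : ℝ) + 2) / (N + 1) * s ^ N * s := by
  have e : ((N : ℝ) + 2) - (N + 1) * s = (N + 2) / (N + 1) := by
    rw [hs]; field_simp; ring
  linear_combination -s ^ (N + 1) * e

theorem revenue_eq_intervalIntegral {N : ℕ} {c vbar : ℝ} {F : ℝ → ℝ} (h : c ≤ vbar)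
    (hF : ∀ v ≥ vbar, F v = 1) :
    revenue (N + 2) c F c =
      c + ∫ v in c..vbar, (1 - ((N : ℝ) + 2) * F v ^ (N + 1) + (N + 1) * F v ^ (N + 2)) := by
  rw [intervalIntegral.integral_of_le h, revenue,
    setIntegral_eq_of_subset_of_forall_sdiff_eq_zero measurableSet_Ioi Ioc_subset_Ioi_self]
  · have e : N + 2 - 1 = N + 1 := rfl
    simp only [e]
    push_cast
    ring_nf
  · rintro v ⟨hv, hv'⟩
    have : vbar ≤ v := by
      by_contra! hlt
      exact hv' ⟨hv, hlt.le⟩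
    simp [hF v this]

theorem le_revenue_of_delta1 {N : ℕ} (hN : 1 ≤ N) {c m vbar : ℝ} (hc : 0 ≤ c) (hcv : c ≤ vbar)
    {F : ℝ → ℝ} (hF : Delta1 m vbar F) :
    vbar - ((N : ℝ) + 2) / (N + 1) * (1 - 1 / ((N : ℝ) + 1) ^ 2) ^ N * (vbar - m) ≤
      revenue (N + 2) c F c := by
  obtain ⟨hmono, -, hneg, hone, hmean⟩ := hF
  have hN' : (1 : ℝ) ≤ N := by exact_mod_cast hN
  have F0 : ∀ v, 0 ≤ F v := fun v => by
    rw [← hneg (min v 0 - 1) (by linarith [min_le_right v 0])]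
    exact hmono (by linarith [min_le_left v 0])
  rw [revenue_eq_intervalIntegral hcv hone]
  set k : ℝ := ((N : ℝ) + 2) / (N + 1) * (1 - 1 / ((N : ℝ) + 1) ^ 2) ^ N with hk
  have hk0 : 0 ≤ k := by
    have : 1 / ((N : ℝ) + 1) ^ 2 ≤ 1 := by
      rw [div_le_one (by positivity)]; nlinarith
    have : 0 ≤ 1 - 1 / ((N : ℝ) + 1) ^ 2 := by linarith
    positivity
  have ii : ∀ a b, IntervalIntegrable F volume a b := fun a b => hmono.intervalIntegrable
  have ip : ∀ j a b, IntervalIntegrable (fun v => F v ^ j) volume a b := fun j a b =>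
    Monotone.intervalIntegrable fun x y hxy => pow_le_pow_left₀ (F0 x) (hmono hxy) j
  have ic : ∀ (d a b : ℝ), IntervalIntegrable (fun _ => d) volume a b := fun _ _ _ =>
    intervalIntegrable_const
  have lower : ∫ v in c..vbar, (1 - k * F v) ≤
      ∫ v in c..vbar, (1 - ((N : ℝ) + 2) * F v ^ (N + 1) + (N + 1) * F v ^ (N + 2)) :=
    intervalIntegral.integral_mono_on hcv ((ic 1 _ _).sub ((ii _ _).const_mul k))
      (((ic 1 _ _).sub ((ip _ _ _).const_mul _)).add ((ip _ _ _).const_mul _))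
      fun v _ => tangent_line_le hN (F0 v)
  rw [intervalIntegral.integral_sub (ic 1 _ _) ((ii _ _).const_mul k),
    intervalIntegral.integral_const_mul] at lower
  rw [intervalIntegral.integral_sub (ic 1 _ _) (ii _ _),
    ← intervalIntegral.integral_add_adjacent_intervals (ii 0 c) (ii c vbar)] at hmean
  have h0 : 0 ≤ ∫ v in (0 : ℝ)..c, F v := intervalIntegral.integral_nonneg hc fun v _ => F0 v
  simp only [intervalIntegral.integral_const, smul_eq_mul, mul_one] at lower hmean
  have : k * ∫ v in c..vbar, F v ≤ k * (vbar - m) :=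
    mul_le_mul_of_nonneg_left (by linarith) hk0
  linarith

theorem maxmin_revenue_formula_delta1
    (n : ℕ) (hn : 3 ≤ n) (c m vbar : ℝ)
    (hc : 0 ≤ c) (hcm : c < m) (hmv : m < vbar)
    (hcond : (vbar - c) / (m - c) ≤ ((n : ℝ) - 1) ^ 2) :
    let αn : ℝ := ((n : ℝ) / ((n : ℝ) - 1)) * (1 - 1 / ((n : ℝ) - 1) ^ 2) ^ (n - 2) - 1
    let vmin : ℝ := m - (vbar - m) / (((n : ℝ) - 1) ^ 2 - 1)
    let qs : ℝ := 1 - 1 / ((n : ℝ) - 1) ^ 2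
    let Fstar : ℝ → ℝ := fun v => if v < vmin then 0 else if v < vbar then qs else 1
    Delta1 m vbar Fstar ∧
      revenue n c Fstar c = m - αn * (vbar - m) ∧
      sInf {x | ∃ F, Delta1 m vbar F ∧ x = revenue n c F c} =
        m - αn * (vbar - m) := by
  intro αn vmin qs Fstar
  obtain ⟨N, rfl⟩ : ∃ N, n = N + 2 := ⟨n - 2, by omega⟩
  have hN : 1 ≤ N := by omega
  have hN' : (1 : ℝ) ≤ N := by exact_mod_cast hN
  have cast_sub : ((N + 2 : ℕ) : ℝ) - 1 = N + 1 := by push_cast; ring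
  have hα : αn = ((N : ℝ) + 2) / (N + 1) * (1 - 1 / ((N : ℝ) + 1) ^ 2) ^ N - 1 := by
    simp only [αn, cast_sub]
    push_cast
    rfl
  have hqs : qs = 1 - 1 / ((N : ℝ) + 1) ^ 2 := by simp only [qs, cast_sub]
  have hvmin : vmin = m - (vbar - m) / (((N : ℝ) + 1) ^ 2 - 1) := by simp only [vmin, cast_sub]
  have hD : 0 < ((N : ℝ) + 1) ^ 2 - 1 := by nlinarith
  have hqs' : qs = (((N : ℝ) + 1) ^ 2 - 1) / ((N : ℝ) + 1) ^ 2 := by rw [hqs]; field_simp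
  have hqs0 : 0 ≤ qs := by rw [hqs']; positivity
  have hqs1 : qs ≤ 1 := by
    rw [hqs]
    have : 0 ≤ 1 / ((N : ℝ) + 1) ^ 2 := by positivity
    linarith
  have hgap : qs * (vbar - vmin) = vbar - m := by
    rw [hqs', hvmin]; field_simp; ring
  have hcvmin : c ≤ vmin := by
    rw [cast_sub, div_le_iff₀ (by linarith)] at hcond
    have : (vbar - m) / (((N : ℝ) + 1) ^ 2 - 1) ≤ m - c := by
      rw [div_le_iff₀ hD]; linarith
    linarith
  have hvminv : vmin ≤ vbar := by
    have : 0 ≤ (vbar - m) / (((N : ℝ) + 1) ^ 2 - 1) := div_nonneg (by linarith) hD.le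
    linarith
  have hmem : Delta1 m vbar Fstar := by
    refine ⟨monotone_two_step hqs0 hqs1, continuousWithinAt_two_step vmin vbar qs, ?_, ?_, ?_⟩
    · intro v hv
      exact if_pos (by linarith)
    · intro v hv
      simp only [Fstar]
      rw [if_neg (by linarith), if_neg (by linarith)]
    · rw [integral_comp_two_step (fun y => 1 - y) (hc.trans hcvmin) hvminv]
      linear_combination -hgap
  have hrev : revenue (N + 2) c Fstar c = m - αn * (vbar - m) := by
    rw [revenue_eq_intervalIntegral (hcvmin.trans hvminv) hmem.2.2.2.1,
      integral_comp_two_step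
        (fun y => 1 - ((N : ℝ) + 2) * y ^ (N + 1) + (N + 1) * y ^ (N + 2)) hcvmin hvminv,
      tangent_line_eq hqs, hα, ← hqs]
    simp only [ne_eq, Nat.add_eq_zero_iff, one_ne_zero, OfNat.ofNat_ne_zero, and_false,
      not_false_eq_true, zero_pow]
    linear_combination -(((N : ℝ) + 2) / (N + 1) * qs ^ N) * hgap
  refine ⟨hmem, hrev, IsLeast.csInf_eq ⟨⟨Fstar, hmem, hrev.symm⟩, ?_⟩⟩
  rintro _ ⟨F, hF, rfl⟩
  refine le_trans (le_of_eq ?_) (le_revenue_of_delta1 hN hc (hcm.trans hmv).le hF)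
  rw [hα]
  ring
end

section
/- Let α_n := (n/(n−1))·(1 − 1/(n−1)²)^{n−2} − 1 for integers n ≥ 3. Then lim_{n→∞} n²·α_n = 1/2. (Consequently, in the known-mean, bounded-values setting the gap m − R̲*_n between the known mean and the maxmin revenue m − α_n·(v̄ − m) is of order Θ(1/n²), and in particular the maxmin revenue of the second-price auction with maxmin reserve converges to m as n → ∞.) -/
open Filter

theorem one_sub_pow_le_quadratic {x : ℝ} (hx : x ≤ 1) (hx0 : 0 ≤ x) (k : ℕ) :
    (1 - x) ^ k ≤ 1 - k * x + k * (k - 1) / 2 * x ^ 2 := by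
  induction k with
  | zero => simp
  | succ k ih =>
    have hk : (0 : ℝ) ≤ k * (k - 1) := by
      rcases k with _ | k
      · simp
      · push_cast
        rw [add_sub_cancel_right]
        positivity
    have h := mul_le_mul_of_nonneg_right ih (sub_nonneg.2 hx)
    have h' := mul_nonneg hk (pow_nonneg hx0 3)
    rw [pow_succ (1 - x)]
    push_cast
    linarith

theorem cubic_le_one_sub_pow {x : ℝ} (hx : x ≤ 1) (hx0 : 0 ≤ x) (k : ℕ) :
    1 - k * x + k * (k - 1) / 2 * x ^ 2 - k * (k - 1) * (k - 2) / 6 * x ^ 3 ≤ (1 - x) ^ k := by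
  induction k with
  | zero => simp
  | succ k ih =>
    have hk : (0 : ℝ) ≤ k * (k - 1) * (k - 2) := by
      rcases k with _ | _ | k
      · simp
      · simp
      · have h : ((k + 1 + 1 : ℕ) : ℝ) * ((k + 1 + 1 : ℕ) - 1) * ((k + 1 + 1 : ℕ) - 2)
            = (k + 2) * (k + 1) * k := by
          push_cast
          ring
        rw [h]
        positivity
    have h := mul_le_mul_of_nonneg_right ih (sub_nonneg.2 hx)
    have h' := mul_nonneg hk (pow_nonneg hx0 4)
    rw [pow_succ (1 - x)]
    push_cast
    linarith

theorem alpha_n_convergence_rate :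
    Filter.Tendsto
      (fun n : ℕ => (n : ℝ) ^ 2 *
        (((n : ℝ) / ((n : ℝ) - 1)) * (1 - 1 / ((n : ℝ) - 1) ^ 2) ^ (n - 2) - 1))
      Filter.atTop (nhds (1 / 2)) := by
  rw [← tendsto_add_atTop_iff_nat 2]
  have hy : Tendsto (fun k : ℕ => 1 / ((k : ℝ) + 1)) atTop (nhds 0) :=
    tendsto_one_div_add_atTop_nhds_zero_nat
  let U : ℝ → ℝ := fun y => (1 + y) ^ 2 * (1 / 2 - y ^ 2 / 2 + y ^ 3)
  let L : ℝ → ℝ := fun y => U y - (1 + y) ^ 3 * (1 - y) * (1 - 2 * y) * (1 - 3 * y) * y / 6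
  have hU : Tendsto U (nhds 0) (nhds (1 / 2)) := by
    have h : Continuous U := by fun_prop
    simpa [U] using h.tendsto 0
  have hL : Tendsto L (nhds 0) (nhds (1 / 2)) := by
    have h : Continuous L := by fun_prop
    simpa [L, U] using h.tendsto 0
  have hbounds (k : ℕ) : L (1 / ((k : ℝ) + 1)) ≤ ((k + 2 : ℕ) : ℝ) ^ 2 *
        ((((k + 2 : ℕ) : ℝ) / (((k + 2 : ℕ) : ℝ) - 1)) *
          (1 - 1 / (((k + 2 : ℕ) : ℝ) - 1) ^ 2) ^ (k + 2 - 2) - 1) ∧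
      ((k + 2 : ℕ) : ℝ) ^ 2 *
        ((((k + 2 : ℕ) : ℝ) / (((k + 2 : ℕ) : ℝ) - 1)) *
          (1 - 1 / (((k + 2 : ℕ) : ℝ) - 1) ^ 2) ^ (k + 2 - 2) - 1) ≤
        U (1 / ((k : ℝ) + 1)) := by
    have hN : (0 : ℝ) < k + 1 := by positivity
    have hx0 : (0 : ℝ) ≤ 1 / ((k : ℝ) + 1) ^ 2 := by positivity
    have hx1 : 1 / ((k : ℝ) + 1) ^ 2 ≤ 1 := by
      rw [div_le_one (by positivity)]
      exact one_le_pow₀ (by linarith [(Nat.cast_nonneg k : (0 : ℝ) ≤ k)])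
    have e1 : ((k + 2 : ℕ) : ℝ) = k + 2 := by push_cast; ring
    have e2 : (k : ℝ) + 2 - 1 = k + 1 := by ring
    rw [e1, e2, Nat.add_sub_cancel]
    have hl := cubic_le_one_sub_pow hx1 hx0 k
    have hu := one_sub_pow_le_quadratic hx1 hx0 k
    constructor
    · calc L (1 / ((k : ℝ) + 1)) = ((k : ℝ) + 2) ^ 2 * (((k : ℝ) + 2) / (k + 1) *
            (1 - k * (1 / ((k : ℝ) + 1) ^ 2) + k * (k - 1) / 2 * (1 / ((k : ℝ) + 1) ^ 2) ^ 2
              - k * (k - 1) * (k - 2) / 6 * (1 / ((k : ℝ) + 1) ^ 2) ^ 3) - 1) := by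
            simp only [L, U]
            field_simp
            ring
        _ ≤ _ := by gcongr
    · calc _ ≤ ((k : ℝ) + 2) ^ 2 * (((k : ℝ) + 2) / (k + 1) *
            (1 - k * (1 / ((k : ℝ) + 1) ^ 2)
              + k * (k - 1) / 2 * (1 / ((k : ℝ) + 1) ^ 2) ^ 2) - 1) := by gcongr
        _ = U (1 / ((k : ℝ) + 1)) := by
            simp only [U]
            field_simp
            ring
  exact tendsto_of_tendsto_of_tendsto_of_le_of_le (hL.comp hy) (hU.comp hy)
    (fun k => (hbounds k).1) (fun k => (hbounds k).2)
end
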